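/- Let K be a number field of degree n > 5 over ℚ. There is a finite set S of rational primes such that for every real σ > n/2 − 7/6 the double series ∑_{p ∉ S} ∑_{i ≥ 2} a^{1,<}_{𝓞_K}(p^i) · p^{−iσ} (sum over primes p not in S and integers i ≥ 2) converges, i.e., is finite. -/

import Mathlib

open NumberField

/-- `a^{1,<}_{𝓞 K}(m)`: the number of orders of the number field `K` (unital subrings
of `𝓞 K` of finite additive index) with additive index exactly `m`. -/
noncomputable def numOrdersOfIndex (K : Type*) [Field K] [NumberField K] (m : ℕ) : ℕ :=
  Nat.card {O : Subring (𝓞 K) // O.toAddSubgroup.index = m}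

/-- A set mapping to a set of at most `k` elements with fibres of size at most `b` has at most
`b * k` elements. -/
theorem Set.encard_le_mul_of_fibers {α β : Type*} (f : α → β) (S : Set α) (T : Set β) (b k : ℕ)
    (hf : ∀ a ∈ S, f a ∈ T) (hT : T.encard ≤ k)
    (hb : ∀ y ∈ T, {a ∈ S | f a = y}.encard ≤ b) : S.encard ≤ (b * k : ℕ) := by
  classical
  have hTf : T.Finite := Set.finite_of_encard_le_coe hT
  have hSf : S.Finite := by
    have : S ⊆ ⋃ y ∈ T, {a ∈ S | f a = y} := fun a ha => by
      simp only [Set.mem_iUnion]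
      exact ⟨f a, hf a ha, ha, rfl⟩
    exact (hTf.biUnion fun y hy => Set.finite_of_encard_le_coe (hb y hy)).subset this
  have h := Finset.card_le_mul_card_image_of_maps_to (f := f) (s := hSf.toFinset)
    (t := hTf.toFinset) (fun a ha => by simpa using hf a (by simpa using ha)) b (by
      intro y hy
      have h1 := hb y (by simpa using hy)
      have h2 : {a ∈ S | f a = y} = ((hSf.toFinset.filter fun a => f a = y : Finset α) : Set α) := by
        ext; simp
      rw [h2, Set.encard_coe_eq_coe_finsetCard] at h1
      exact_mod_cast h1)
  rw [← hSf.coe_toFinset, Set.encard_coe_eq_coe_finsetCard]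
  rw [← hTf.coe_toFinset, Set.encard_coe_eq_coe_finsetCard] at hT
  have hT' : hTf.toFinset.card ≤ k := by exact_mod_cast hT
  exact_mod_cast h.trans (Nat.mul_le_mul_left _ hT')

theorem two_mul_pow_sub_pow {p k i : ℕ} (hp : 2 ≤ p) (hi : i < k) :
    p ^ k ≤ 2 * (p ^ k - p ^ i) := by
  have : 2 * p ^ i ≤ p ^ k := calc
    2 * p ^ i ≤ p * p ^ i := Nat.mul_le_mul_right _ hp
    _ = p ^ (i + 1) := by ring
    _ ≤ p ^ k := Nat.pow_le_pow_right (by omega) hi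
  omega

/-- The number of `k`-dimensional subspaces of an `m`-dimensional space over `ZMod p`. -/
theorem card_submodule_le {p : ℕ} [Fact p.Prime] {V : Type*} [AddCommGroup V] [Module (ZMod p) V]
    [Finite V] {m k : ℕ} (hV : Nat.card V = p ^ m) :
    Nat.card {W : Submodule (ZMod p) V // Nat.card W = p ^ k} ≤ 2 ^ k * p ^ (k * (m - k)) := by
  classical
  have hp : 2 ≤ p := (Fact.out : p.Prime).two_le
  by_cases hne : Nonempty {W : Submodule (ZMod p) V // Nat.card W = p ^ k}
  swap
  · rw [not_nonempty_iff] at hne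
    simp
  have hkm : k ≤ m := by
    obtain ⟨W, hW⟩ := hne
    have := Nat.card_le_card_of_injective (Subtype.val : W → V) Subtype.val_injective
    rw [hW, hV] at this
    exact (Nat.pow_le_pow_iff_right hp).1 this
  have hcard (W : {W : Submodule (ZMod p) V // Nat.card W = p ^ k}) :
      Module.finrank (ZMod p) W.1 = k := by
    have := Module.natCard_eq_pow_finrank (K := ZMod p) (V := W.1)
    rw [W.2, Nat.card_zmod] at this
    exact (Nat.pow_right_injective hp this).symm
  set P := ∏ i : Fin k, (p ^ k - p ^ i.val) with hP
  have hLI (W : {W : Submodule (ZMod p) V // Nat.card W = p ^ k}) :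
      Nat.card {s : Fin k → W.1 // LinearIndependent (ZMod p) s} = P := by
    have := card_linearIndependent (K := ZMod p) (V := W.1) (k := k) (hcard W).ge
    rw [this, hcard W, ZMod.card]
  have hinj : Function.Injective (fun x : (Σ W : {W : Submodule (ZMod p) V // Nat.card W = p ^ k},
      {s : Fin k → W.1 // LinearIndependent (ZMod p) s}) => fun i => ((x.2.1 i : x.1.1) : V)) := by
    rintro ⟨W, s, hs⟩ ⟨W', s', hs'⟩ h
    have key (W : {W : Submodule (ZMod p) V // Nat.card W = p ^ k}) (s : Fin k → W.1)
        (hs : LinearIndependent (ZMod p) s) :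
        Submodule.span (ZMod p) (Set.range fun i => (s i : V)) = W.1 := by
      have := hs.span_eq_top_of_card_eq_finrank' (by simp [hcard W])
      have h2 : (Set.range fun i => (s i : V)) = W.1.subtype '' Set.range s := by
        rw [← Set.range_comp]; rfl
      rw [h2, ← Submodule.map_span, this]
      simp
    have hW : W = W' := by
      apply Subtype.ext
      rw [← key W s hs, ← key W' s' hs']
      simp only at h
      rw [h]
    subst hW
    congr
    funext i
    exact Subtype.ext (congrFun h i)
  have : Finite {W : Submodule (ZMod p) V // Nat.card W = p ^ k} := Subtype.finite
  let _ := Fintype.ofFinite {W : Submodule (ZMod p) V // Nat.card W = p ^ k}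
  have h1 := Nat.card_le_card_of_injective _ hinj
  rw [Nat.card_sigma, Finset.sum_congr rfl (fun W _ => hLI W), Finset.sum_const, Nat.card_fun,
    hV, Nat.card_fin, smul_eq_mul, Finset.card_univ, ← Nat.card_eq_fintype_card] at h1
  have h2 : p ^ (k * k) ≤ 2 ^ k * P := by
    have : ∏ i : Fin k, p ^ k ≤ ∏ i : Fin k, (2 * (p ^ k - p ^ i.val)) :=
      Finset.prod_le_prod' fun i _ => two_mul_pow_sub_pow hp i.2
    rw [Finset.prod_mul_distrib] at this
    simpa [pow_mul] using this
  have hpos : 0 < p ^ (k * k) := by positivity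
  refine Nat.le_of_mul_le_mul_right ?_ hpos
  set c := Nat.card {W : Submodule (ZMod p) V // Nat.card W = p ^ k}
  calc c * p ^ (k * k) ≤ c * (2 ^ k * P) := Nat.mul_le_mul_left _ h2
    _ = 2 ^ k * (c * P) := by ring
    _ ≤ 2 ^ k * (p ^ m) ^ k := Nat.mul_le_mul_left _ h1
    _ = 2 ^ k * p ^ (k * (m - k)) * p ^ (k * k) := by
      rw [← pow_mul, mul_assoc, ← pow_add, ← mul_add, Nat.sub_add_cancel hkm, mul_comm k m]

theorem card_addSubgroup_card_eq_le {p : ℕ} (hp : p.Prime) {V : Type*} [AddCommGroup V]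
    [Finite V] {m k : ℕ} (hV : Nat.card V = p ^ m) (hpV : ∀ v : V, p • v = 0) :
    Nat.card {W : AddSubgroup V // Nat.card W = p ^ k} ≤ 2 ^ k * p ^ (k * (m - k)) := by
  have : Fact p.Prime := ⟨hp⟩
  have key [Module (ZMod p) V] :
      Nat.card {W : AddSubgroup V // Nat.card W = p ^ k} ≤ 2 ^ k * p ^ (k * (m - k)) := by
    let F (W : {W : AddSubgroup V // Nat.card W = p ^ k}) :
        {W : Submodule (ZMod p) V // Nat.card W = p ^ k} :=
      ⟨AddSubgroup.toZModSubmodule p W.1, W.2⟩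
    have hF : Function.Injective F := fun W W' h =>
      Subtype.ext ((AddSubgroup.toZModSubmodule p).injective (congrArg Subtype.val h))
    exact (Nat.card_le_card_of_injective F hF).trans (card_submodule_le hV)
  exact @key (AddCommGroup.zmodModule hpV)

/-- Subgroups of index `p ^ c` of an elementary abelian group of order `p ^ n` which contain a
given subgroup of order at least `p ^ d`. -/
theorem encard_addSubgroup_le {p : ℕ} (hp : p.Prime) {V : Type*} [AddCommGroup V]
    {n c d : ℕ} (hV : Nat.card V = p ^ n) (hpV : ∀ v : V, p • v = 0) (D : AddSubgroup V)
    (hD : p ^ d ≤ Nat.card D) :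
    {W : AddSubgroup V | D ≤ W ∧ W.index = p ^ c}.encard ≤
      (2 ^ n * p ^ (c * (n - d - c)) : ℕ) := by
  classical
  have : Fact p.Prime := ⟨hp⟩
  have hfin : Finite V := Nat.finite_of_card_ne_zero (by rw [hV]; exact (pow_pos hp.pos _).ne')
  obtain ⟨d', hd'n, hd'⟩ := (Nat.dvd_prime_pow hp).1 (hV ▸ AddSubgroup.card_addSubgroup_dvd_card D)
  have hdd' : d ≤ d' := (Nat.pow_le_pow_iff_right hp.one_lt).1 (hd' ▸ hD)
  have hpQ : ∀ x : V ⧸ D, p • x = 0 := (fun x => by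
    obtain ⟨v, rfl⟩ := QuotientAddGroup.mk_surjective x
    rw [← QuotientAddGroup.mk_nsmul, hpV, QuotientAddGroup.mk_zero])
  have hQ : Nat.card (V ⧸ D) = p ^ (n - d') := by
    have := AddSubgroup.card_mul_index D
    rw [hd', hV, AddSubgroup.index_eq_card] at this
    rw [← Nat.sub_add_cancel hd'n, pow_add, mul_comm] at this
    exact Nat.eq_of_mul_eq_mul_right (pow_pos hp.pos _) this
  set S := {W : AddSubgroup V | D ≤ W ∧ W.index = p ^ c}
  by_cases hc : S.Nonempty
  swap
  · rw [Set.not_nonempty_iff_eq_empty] at hc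
    rw [hc]; simp
  have hsub (W : AddSubgroup V) (hW : D ≤ W) :
      (W.map (QuotientAddGroup.mk' D)).comap (QuotientAddGroup.mk' D) = W := by
    rw [AddSubgroup.comap_map_eq, QuotientAddGroup.ker_mk', sup_eq_left.2 hW]
  have hidx (W : AddSubgroup V) (hW : D ≤ W) :
      (W.map (QuotientAddGroup.mk' D)).index = W.index := by
    conv_rhs => rw [← hsub W hW]
    rw [AddSubgroup.index_comap_of_surjective _ (QuotientAddGroup.mk'_surjective D)]
  have hcardW (W : AddSubgroup V) (hW : W ∈ S) : c ≤ n - d' ∧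
      Nat.card (W.map (QuotientAddGroup.mk' D)) = p ^ (n - d' - c) := by
    have h1 := AddSubgroup.card_mul_index (W.map (QuotientAddGroup.mk' D))
    rw [hidx W hW.1, hW.2, hQ] at h1
    have h2 : c ≤ n - d' := (Nat.pow_dvd_pow_iff_le_right hp.one_lt).1 (Dvd.intro_left _ h1)
    refine ⟨h2, Nat.eq_of_mul_eq_mul_right (pow_pos hp.pos c) ?_⟩
    rw [h1, ← pow_add, Nat.sub_add_cancel h2]
  obtain ⟨W₀, hW₀⟩ := hc
  have hcn := (hcardW W₀ hW₀).1
  let F (W : S) : {U : AddSubgroup (V ⧸ D) // Nat.card U = p ^ (n - d' - c)} :=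
    ⟨W.1.map (QuotientAddGroup.mk' D), (hcardW W.1 W.2).2⟩
  have hinj : Function.Injective F := by
    intro W W' h
    apply Subtype.ext
    rw [← hsub W.1 W.2.1, ← hsub W'.1 W'.2.1]
    exact congrArg (AddSubgroup.comap _) (congrArg Subtype.val h)
  have h1 := (Nat.card_le_card_of_injective _ hinj).trans (card_addSubgroup_card_eq_le hp hQ hpQ)
  rw [Nat.card_coe_set_eq] at h1
  rw [← (Set.toFinite S).cast_ncard_eq]
  refine Nat.cast_le.2 (h1.trans ?_)
  refine Nat.mul_le_mul (Nat.pow_le_pow_right (by norm_num) (by omega))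
    (Nat.pow_le_pow_right hp.pos ?_)
  rw [mul_comm]
  exact Nat.mul_le_mul (by omega) (by omega)

/-- `R` has no `p`-torsion and `R / pR` has `p ^ n` elements. -/
structure HasPRank (R : Type*) [CommRing R] (p n : ℕ) : Prop where
  prime : p.Prime
  inj : Function.Injective fun x : R => (p : R) * x
  card : Nat.card (R ⧸ Ideal.span {(p : R)}) = p ^ n

section Lattices

variable {R : Type*} [CommRing R] {p n : ℕ}

/-- The elements `x` with `p ^ t * x ∈ H`. -/
def pColon (p t : ℕ) (H : AddSubgroup R) : AddSubgroup R :=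
  H.comap (AddMonoidHom.mulLeft ((p : R) ^ t))

theorem mem_pColon {t : ℕ} {H : AddSubgroup R} {x : R} :
    x ∈ pColon p t H ↔ (p : R) ^ t * x ∈ H := Iff.rfl

theorem pColon_zero (H : AddSubgroup R) : pColon p 0 H = H := by
  ext x; simp [mem_pColon]

theorem pColon_pColon (s t : ℕ) (H : AddSubgroup R) :
    pColon p s (pColon p t H) = pColon p (s + t) H := by
  ext x
  simp only [mem_pColon]
  rw [← mul_assoc, ← pow_add, add_comm]

theorem natCast_mul_mem (H : AddSubgroup R) (m : ℕ) {x : R} (hx : x ∈ H) : (m : R) * x ∈ H := by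
  rw [← nsmul_eq_mul]; exact H.nsmul_mem hx m

theorem natCast_pow_mul_mem (H : AddSubgroup R) (m t : ℕ) {x : R} (hx : x ∈ H) :
    (m : R) ^ t * x ∈ H := by
  rw [← Nat.cast_pow]; exact natCast_mul_mem H _ hx

theorem pColon_mono_right {s t : ℕ} (h : s ≤ t) (H : AddSubgroup R) :
    pColon p s H ≤ pColon p t H := by
  intro x hx
  rw [mem_pColon] at *
  obtain ⟨k, rfl⟩ := Nat.exists_eq_add_of_le h
  rw [add_comm, pow_add, mul_assoc]
  exact natCast_pow_mul_mem H _ _ hx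

theorem le_pColon (t : ℕ) (H : AddSubgroup R) : H ≤ pColon p t H := by
  simpa [pColon_zero] using pColon_mono_right (p := p) (Nat.zero_le t) H

/-- The lattice `pM`. -/
def pMul (p : ℕ) (M : AddSubgroup R) : AddSubgroup R := M.map (AddMonoidHom.mulLeft (p : R))

theorem mem_pMul {M : AddSubgroup R} {x : R} : x ∈ pMul p M ↔ ∃ y ∈ M, (p : R) * y = x := Iff.rfl

theorem pMul_le (M : AddSubgroup R) : pMul p M ≤ M := by
  rintro _ ⟨y, hy, rfl⟩
  exact natCast_mul_mem M p hy

/-- Reduction modulo `p`. -/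
abbrev redMod (R : Type*) [CommRing R] (p : ℕ) : R →+* R ⧸ Ideal.span {(p : R)} :=
  Ideal.Quotient.mk _

theorem redMod_eq_zero {x : R} : redMod R p x = 0 ↔ ∃ y, (p : R) * y = x := by
  rw [Ideal.Quotient.eq_zero_iff_mem, Ideal.mem_span_singleton, dvd_def]
  exact ⟨fun ⟨c, h⟩ => ⟨c, h.symm⟩, fun ⟨c, h⟩ => ⟨c, h.symm⟩⟩

theorem redMod_ker : (redMod R p).toAddMonoidHom.ker = pMul p ⊤ := by
  ext x
  rw [AddMonoidHom.mem_ker, mem_pMul]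
  simpa using redMod_eq_zero

theorem HasPRank.index_pMul (h : HasPRank R p n) (M : AddSubgroup R) :
    (pMul p M).index = M.index * p ^ n := by
  have h1 : (AddMonoidHom.mulLeft (p : R)).range.index = p ^ n := by
    rw [← h.card, AddMonoidHom.range_eq_map]
    change (pMul p ⊤).index = _
    rw [← redMod_ker, AddSubgroup.index_ker]
    rw [AddMonoidHom.range_eq_top_of_surjective _ Ideal.Quotient.mk_surjective]
    exact AddSubgroup.card_top
  rw [pMul, AddSubgroup.index_map_of_injective _ (by exact h.inj), h1]

theorem HasPRank.relIndex_pMul (h : HasPRank R p n) {M : AddSubgroup R} (hM : M.index ≠ 0) :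
    (pMul p M).relIndex M = p ^ n := by
  have h1 := AddSubgroup.relIndex_mul_index (pMul_le (p := p) M)
  rw [h.index_pMul M, mul_comm] at h1
  exact Nat.eq_of_mul_eq_mul_left (Nat.pos_of_ne_zero hM) h1

/-- The image of a lattice in `R / pR`. -/
abbrev redMap (p : ℕ) (H : AddSubgroup R) : AddSubgroup (R ⧸ Ideal.span {(p : R)}) :=
  H.map (redMod R p).toAddMonoidHom

theorem pMul_le_of_pColon_one {H M : AddSubgroup R} (h : pColon p 1 H = M) : pMul p M ≤ H := by
  rintro _ ⟨y, hy, rfl⟩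
  rw [SetLike.mem_coe, ← h, mem_pColon, pow_one] at hy
  exact hy

theorem HasPRank.encard_step (h : HasPRank R p n) {M : AddSubgroup R} (hM : M.index ≠ 0)
    (K : Set R) {c d : ℕ} (hK : p ^ d ≤ Nat.card (redMap p (AddSubgroup.closure K))) :
    {H : AddSubgroup R | pColon p 1 H = M ∧ H.relIndex M = p ^ c ∧ K ⊆ H}.encard ≤
      (2 ^ n * p ^ (c * (n - d - c)) : ℕ) := by
  set S := {H : AddSubgroup R | pColon p 1 H = M ∧ H.relIndex M = p ^ c ∧ K ⊆ H}
  by_cases hS : S.Nonempty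
  swap
  · rw [Set.not_nonempty_iff_eq_empty] at hS
    rw [hS]; simp
  have hle (H : AddSubgroup R) (hH : H ∈ S) : H ≤ M := by
    rw [← hH.1]; exact le_pColon 1 H
  have hKM : AddSubgroup.closure K ≤ M := by
    obtain ⟨H, hH⟩ := hS
    exact ((AddSubgroup.closure_le H).2 hH.2.2).trans (hle H hH)
  set P : AddSubgroup M := (pMul p M).addSubgroupOf M
  set q : M →+ M ⧸ P := QuotientAddGroup.mk' P
  have hq : Function.Surjective q := QuotientAddGroup.mk'_surjective P
  have hcardV : Nat.card (M ⧸ P) = p ^ n := h.relIndex_pMul hM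
  have hpV : ∀ v : M ⧸ P, p • v = 0 := by
    intro v
    obtain ⟨x, rfl⟩ := hq v
    rw [← map_nsmul]
    refine (QuotientAddGroup.eq_zero_iff _).2 ?_
    rw [AddSubgroup.mem_addSubgroupOf, mem_pMul]
    exact ⟨x, x.2, by simp⟩
  have hfin : Finite (M ⧸ P) :=
    Nat.finite_of_card_ne_zero (by rw [hcardV]; exact (pow_pos h.prime.pos _).ne')
  set D : AddSubgroup (M ⧸ P) := ((AddSubgroup.closure K).addSubgroupOf M).map q
  have hker : P ≤ ((redMod R p).toAddMonoidHom.comp M.subtype).ker := by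
    intro x hx
    rw [AddSubgroup.mem_addSubgroupOf, mem_pMul] at hx
    obtain ⟨y, -, hy⟩ := hx
    exact redMod_eq_zero.2 ⟨y, hy⟩
  have hD : p ^ d ≤ Nat.card D := by
    refine hK.trans ?_
    set g : M ⧸ P →+ R ⧸ Ideal.span {(p : R)} := QuotientAddGroup.lift P _ hker
    have : D.map g = redMap p (AddSubgroup.closure K) := by
      ext y
      constructor
      · rintro ⟨_, ⟨x, hx, rfl⟩, rfl⟩
        exact ⟨x, hx, rfl⟩
      · rintro ⟨x, hx, rfl⟩
        exact ⟨_, ⟨⟨x, hKM hx⟩, hx, rfl⟩, rfl⟩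
    rw [← this]
    exact Nat.card_le_card_of_surjective _ (g.addSubgroupMap_surjective D)
  have hPle (H : AddSubgroup R) (hH : H ∈ S) : P ≤ H.addSubgroupOf M := by
    intro x hx
    exact pMul_le_of_pColon_one hH.1 hx
  have hcm (H : AddSubgroup R) (hH : H ∈ S) :
      ((H.addSubgroupOf M).map q).comap q = H.addSubgroupOf M := by
    rw [AddSubgroup.comap_map_eq, QuotientAddGroup.ker_mk', sup_eq_left.2 (hPle H hH)]
  refine le_trans ?_ (encard_addSubgroup_le h.prime hcardV hpV D hD (c := c))
  refine Set.encard_le_encard_of_injOn (f := fun H => (H.addSubgroupOf M).map q) ?_ ?_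
  · intro H hH
    refine ⟨AddSubgroup.map_mono ?_, ?_⟩
    · intro x hx
      exact (AddSubgroup.closure_le H).2 hH.2.2 hx
    · rw [← AddSubgroup.index_comap_of_surjective _ hq, hcm H hH]
      exact hH.2.1
  · intro H hH H' hH' hHH'
    have h1 : H.addSubgroupOf M = H'.addSubgroupOf M := by
      rw [← hcm H hH, ← hcm H' hH']
      exact congrArg _ hHH'
    rw [AddSubgroup.addSubgroupOf_inj, inf_eq_left.2 (hle H hH), inf_eq_left.2 (hle H' hH')] at h1
    exact h1

/-- The jump condition: `[N_{t+1} : N_t] = p ^ (c t)` for `t < s`. -/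
def HasJumps (p : ℕ) (L : AddSubgroup R) (s : ℕ) (c : ℕ → ℕ) : Prop :=
  ∀ t < s, (pColon p t L).relIndex (pColon p (t + 1) L) = p ^ c t

theorem HasJumps.index {L : AddSubgroup R} {s : ℕ} {c : ℕ → ℕ} (h : HasJumps p L s c) :
    L.index = p ^ (∑ t ∈ Finset.range s, c t) * (pColon p s L).index := by
  induction s with
  | zero => simp [pColon_zero]
  | succ s ih =>
    rw [ih fun t ht => h t (by omega), Finset.sum_range_succ, pow_add,
      ← h s (by omega), mul_assoc,
      AddSubgroup.relIndex_mul_index (pColon_mono_right (Nat.le_succ s) L)]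

theorem HasPRank.encard_chain (h : HasPRank R p n) {M : AddSubgroup R} (hM : M.index ≠ 0)
    (s : ℕ) (c d : ℕ → ℕ) (K : ℕ → Set R)
    (hK : ∀ t < s, p ^ d t ≤ Nat.card (redMap p (AddSubgroup.closure (K t)))) :
    {L : AddSubgroup R | pColon p s L = M ∧ HasJumps p L s c ∧
        ∀ t < s, K t ⊆ pColon p t L}.encard ≤
      (∏ t ∈ Finset.range s, (2 ^ n * p ^ (c t * (n - d t - c t))) : ℕ) := by
  induction s generalizing c d K with
  | zero =>
    refine le_trans (Set.encard_le_encard (t := {M}) ?_) (by simp)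
    rintro L ⟨hL, -⟩
    simpa [pColon_zero] using hL
  | succ s ih =>
    have ih' := ih (fun t => c (t + 1)) (fun t => d (t + 1)) (fun t => K (t + 1))
      (fun t ht => hK (t + 1) (by omega))
    rw [Finset.prod_range_succ', mul_comm]
    refine Set.encard_le_mul_of_fibers (pColon p 1) _ _ _ _ ?_ ih' ?_
    · rintro L ⟨hL, hj, hKL⟩
      refine ⟨by rw [pColon_pColon, hL], fun t ht => ?_, fun t ht => ?_⟩
      · rw [pColon_pColon, pColon_pColon, add_right_comm]
        exact hj (t + 1) (by omega)
      · rw [pColon_pColon]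
        exact hKL (t + 1) (by omega)
    · rintro H ⟨hH, hj, -⟩
      have hHi : H.index ≠ 0 := by
        rw [hj.index, hH]
        exact mul_ne_zero (pow_pos h.prime.pos _).ne' hM
      refine le_trans (Set.encard_le_encard ?_)
        (h.encard_step hHi (K 0) (c := c 0) (hK 0 (by omega)))
      rintro L ⟨⟨hL, hjL, hKL⟩, rfl⟩
      refine ⟨rfl, ?_, ?_⟩
      · simpa [pColon_zero] using hjL 0 (Nat.succ_pos s)
      · simpa [pColon_zero] using hKL 0 (Nat.succ_pos s)

theorem pMul_pColon_succ (L : AddSubgroup R) (t : ℕ) :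
    pMul p (pColon p (t + 1) L) = pColon p t L ⊓ pMul p ⊤ := by
  ext x
  simp only [AddSubgroup.mem_inf, mem_pMul, mem_pColon, AddSubgroup.mem_top, true_and]
  constructor
  · rintro ⟨y, hy, rfl⟩
    exact ⟨by rwa [← mul_assoc, ← pow_succ], y, rfl⟩
  · rintro ⟨h1, y, rfl⟩
    exact ⟨y, by rwa [← mul_assoc, ← pow_succ] at h1, rfl⟩

/-- The image of `N_t` in `R / pR` has codimension the jump `[N_{t+1} : N_t]`. -/
theorem HasPRank.card_redMap_pColon (h : HasPRank R p n) {L : AddSubgroup R} (hL : L.index ≠ 0)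
    (t : ℕ) :
    Nat.card (redMap p (pColon p t L)) *
      (pColon p t L).relIndex (pColon p (t + 1) L) = p ^ n := by
  have hle := pColon_mono_right (p := p) (Nat.le_succ t) L
  have hidx : (pColon p (t + 1) L).index ≠ 0 := fun h0 => hL <| by
    rw [← AddSubgroup.relIndex_mul_index (le_pColon (p := p) (t + 1) L), h0, mul_zero]
  have h1 : (pMul p (pColon p (t + 1) L)).relIndex (pColon p t L) =
      Nat.card (redMap p (pColon p t L)) := by
    rw [pMul_pColon_succ, AddSubgroup.inf_relIndex_left, ← redMod_ker]
    exact AddSubgroup.relIndex_ker _ _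
  rw [← h1, AddSubgroup.relIndex_mul_relIndex _ _ _ _ hle, h.relIndex_pMul hidx]
  rw [pMul_pColon_succ]
  exact inf_le_left

end Lattices

section Jumps

variable {R : Type*} [CommRing R] {p n : ℕ}

/-- The exponent of `p` in `[N_{t+1} : N_t]`. -/
noncomputable def jump (p : ℕ) (L : AddSubgroup R) (t : ℕ) : ℕ :=
  Nat.log p ((pColon p t L).relIndex (pColon p (t + 1) L))

theorem HasPRank.relIndex_eq_jump (h : HasPRank R p n) {L : AddSubgroup R} (hL : L.index ≠ 0)
    (t : ℕ) : (pColon p t L).relIndex (pColon p (t + 1) L) = p ^ jump p L t := by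
  obtain ⟨k, -, hk⟩ := (Nat.dvd_prime_pow h.prime).1
    (Dvd.intro_left _ (h.card_redMap_pColon hL t))
  rw [jump, hk, Nat.log_pow h.prime.one_lt]

theorem HasPRank.jump_le (h : HasPRank R p n) {L : AddSubgroup R} (hL : L.index ≠ 0) (t : ℕ) :
    jump p L t ≤ n := by
  have := Dvd.intro_left _ (h.card_redMap_pColon hL t)
  rw [h.relIndex_eq_jump hL] at this
  exact (Nat.pow_dvd_pow_iff_le_right h.prime.one_lt).1 this

theorem HasPRank.hasJumps (h : HasPRank R p n) {L : AddSubgroup R} (hL : L.index ≠ 0) (s : ℕ) :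
    HasJumps p L s (jump p L) := fun t _ => h.relIndex_eq_jump hL t

theorem HasPRank.card_redMap (h : HasPRank R p n) {L : AddSubgroup R} (hL : L.index ≠ 0)
    (t : ℕ) : Nat.card (redMap p (pColon p t L)) = p ^ (n - jump p L t) := by
  have h1 := h.card_redMap_pColon hL t
  rw [h.relIndex_eq_jump hL] at h1
  refine Nat.eq_of_mul_eq_mul_right (pow_pos h.prime.pos (jump p L t)) ?_
  rw [h1, ← pow_add, Nat.sub_add_cancel (h.jump_le hL t)]

theorem HasPRank.finite_quot (h : HasPRank R p n) : Finite (R ⧸ Ideal.span {(p : R)}) :=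
  Nat.finite_of_card_ne_zero (by rw [h.card]; exact (pow_pos h.prime.pos _).ne')

theorem HasPRank.jump_le_of_le (h : HasPRank R p n) {L M : AddSubgroup R} (hL : L.index ≠ 0)
    (hM : M.index ≠ 0) {s t : ℕ} (hle : pColon p s L ≤ pColon p t M) :
    jump p M t ≤ jump p L s := by
  have := h.finite_quot
  have h1 := Nat.card_mono (Set.toFinite _)
    (show (redMap p (pColon p s L) : Set (R ⧸ Ideal.span {(p : R)})) ⊆
      (redMap p (pColon p t M) : Set (R ⧸ Ideal.span {(p : R)})) from AddSubgroup.map_mono hle)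
  simp only [SetLike.coe_sort_coe] at h1
  rw [h.card_redMap hL, h.card_redMap hM, Nat.pow_le_pow_iff_right h.prime.one_lt] at h1
  have h2 := h.jump_le hL s
  have h3 := h.jump_le hM t
  omega

theorem HasPRank.jump_antitone (h : HasPRank R p n) {L : AddSubgroup R} (hL : L.index ≠ 0) :
    Antitone (jump p L) := fun _ _ hst => h.jump_le_of_le hL hL (pColon_mono_right hst L)

end Jumps

section Conductor

variable {R : Type*} [CommRing R] {p n : ℕ}

/-- The ideal of all `x` with `p ^ t * x * R ⊆ L`. -/
def condIdeal (p : ℕ) (L : Subring R) (t : ℕ) : Ideal R where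
  carrier := {x | ∀ r : R, (p : R) ^ t * (x * r) ∈ L}
  zero_mem' r := by simp [L.zero_mem]
  add_mem' {a b} ha hb r := by
    rw [add_mul, mul_add]; exact L.add_mem (ha r) (hb r)
  smul_mem' c x hx r := by
    have := hx (c * r)
    rwa [smul_eq_mul, mul_assoc, mul_left_comm c x r]

theorem mem_condIdeal {L : Subring R} {t : ℕ} {x : R} :
    x ∈ condIdeal p L t ↔ ∀ r : R, (p : R) ^ t * (x * r) ∈ L := Iff.rfl

/-- The conductor of `L`, as an additive subgroup. -/
abbrev condGroup (p : ℕ) (L : Subring R) : AddSubgroup R := (condIdeal p L 0).toAddSubgroup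

theorem pColon_condGroup (L : Subring R) (t : ℕ) :
    pColon p t (condGroup p L) = (condIdeal p L t).toAddSubgroup := by
  ext x
  simp [mem_pColon, mem_condIdeal, mul_assoc]

theorem condIdeal_le_pColon (L : Subring R) (t : ℕ) :
    (condIdeal p L t).toAddSubgroup ≤ pColon p t L.toAddSubgroup := by
  intro x hx
  have := hx 1
  rwa [mul_one] at this

/-- `e` is the least exponent with `p ^ e * R ⊆ L`. -/
def IsPExponent (p : ℕ) (L : AddSubgroup R) (e : ℕ) : Prop :=
  pColon p e L = ⊤ ∧ ∀ t < e, pColon p t L ≠ ⊤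

theorem exists_isPExponent {L : AddSubgroup R} {i : ℕ} (hL : L.index = p ^ i) :
    ∃ e ≤ i, IsPExponent p L e := by
  classical
  have h1 : ∃ e, pColon p e L = ⊤ := ⟨i, by
    rw [eq_top_iff]
    intro x _
    rw [mem_pColon, ← Nat.cast_pow, ← nsmul_eq_mul, ← hL]
    exact L.nsmul_index_mem x⟩
  refine ⟨Nat.find h1, Nat.find_min' h1 ?_, Nat.find_spec h1, fun t ht => Nat.find_min h1 ht⟩
  rw [eq_top_iff]
  intro x _
  rw [mem_pColon, ← Nat.cast_pow, ← nsmul_eq_mul, ← hL]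
  exact L.nsmul_index_mem x

theorem IsPExponent.pow_mul_mem {L : AddSubgroup R} {e : ℕ} (h : IsPExponent p L e) (x : R) :
    (p : R) ^ e * x ∈ L := by
  have : x ∈ pColon p e L := by rw [h.1]; trivial
  exact this

theorem IsPExponent.pow_mul_mem_of_le {L : AddSubgroup R} {e t : ℕ} (h : IsPExponent p L e)
    (het : e ≤ t) (x : R) : (p : R) ^ t * x ∈ L := by
  obtain ⟨k, rfl⟩ := Nat.exists_eq_add_of_le het
  rw [pow_add, mul_assoc]
  exact h.pow_mul_mem _

theorem IsPExponent.condIdeal_eq_top {L : Subring R} {e : ℕ}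
    (h : IsPExponent p L.toAddSubgroup e) : condIdeal p L e = ⊤ := by
  rw [Ideal.eq_top_iff_one]
  intro r
  exact h.pow_mul_mem _

theorem IsPExponent.condIdeal_ne_top {L : Subring R} {e t : ℕ}
    (h : IsPExponent p L.toAddSubgroup e) (ht : t < e) : condIdeal p L t ≠ ⊤ := by
  intro h1
  apply h.2 t ht
  rw [eq_top_iff]
  exact le_trans (by rw [h1]; intro x _; trivial) (condIdeal_le_pColon L t)

theorem IsPExponent.condGroup_index_ne_zero {L : Subring R} {e : ℕ} (hR : HasPRank R p n)
    (h : IsPExponent p L.toAddSubgroup e) : (condGroup p L).index ≠ 0 := by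
  have key : ∀ k, ∀ M : AddSubgroup R, pColon p k M = ⊤ → M.index ≠ 0 := by
    intro k
    induction k with
    | zero => intro M hM; rw [pColon_zero] at hM; simp [hM]
    | succ k ih =>
      intro M hM h0
      rw [← pColon_pColon] at hM
      have h1 := ih _ hM
      have h2 := pMul_le_of_pColon_one (p := p) (H := M) rfl
      have h3 := AddSubgroup.index_dvd_of_le h2
      rw [hR.index_pMul, h0, zero_dvd_iff] at h3
      exact mul_ne_zero h1 (pow_pos hR.prime.pos _).ne' h3
  refine key e _ ?_
  rw [pColon_condGroup, h.condIdeal_eq_top]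
  rfl

/-- The ideal of `R / pR` cut out by `condIdeal`. -/
def condMod (p : ℕ) (L : Subring R) (t : ℕ) : Ideal (R ⧸ Ideal.span {(p : R)}) :=
  (condIdeal p L t).map (redMod R p)

theorem mem_condMod {L : Subring R} {t : ℕ} {z : R ⧸ Ideal.span {(p : R)}} :
    z ∈ condMod p L t ↔ ∃ x ∈ condIdeal p L t, redMod R p x = z :=
  Ideal.mem_map_iff_of_surjective _ Ideal.Quotient.mk_surjective

theorem condMod_toAddSubgroup (L : Subring R) (t : ℕ) :
    (condMod p L t).toAddSubgroup = redMap p (pColon p t (condGroup p L)) := by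
  ext z
  rw [pColon_condGroup]
  exact mem_condMod

theorem IsPExponent.one_notMem_condMod {L : Subring R} {e t : ℕ}
    (h : IsPExponent p L.toAddSubgroup e) (ht : t < e) : 1 ∉ condMod p L t := by
  intro h1
  obtain ⟨x, hx, hx1⟩ := mem_condMod.1 h1
  obtain ⟨y, hy⟩ := redMod_eq_zero.1 (show redMod R p (1 - x) = 0 by rw [map_sub, hx1]; simp)
  apply h.condIdeal_ne_top ht
  rw [Ideal.eq_top_iff_one]
  have h2 : x ∣ 1 ^ (e - t) - ((p : R) * y) ^ (e - t) := by
    have := sub_dvd_pow_sub_pow 1 ((p : R) * y) (e - t)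
    rw [hy, sub_sub_cancel] at this
    rwa [hy]
  have h3 : ((p : R) * y) ^ (e - t) ∈ condIdeal p L t := by
    intro r
    rw [mul_pow, mul_assoc, ← mul_assoc, ← pow_add, Nat.add_sub_cancel' ht.le]
    exact h.pow_mul_mem _
  have h4 := (condIdeal p L t).add_mem (Ideal.mem_of_dvd _ h2 hx) h3
  simpa using h4

theorem one_mem_pColon (L : Subring R) (t : ℕ) : 1 ∈ pColon p t L.toAddSubgroup :=
  le_pColon t L.toAddSubgroup L.one_mem

theorem mul_mem_pColon {L : Subring R} {s t : ℕ} {x y : R} (hx : x ∈ pColon p s L.toAddSubgroup)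
    (hy : y ∈ pColon p t L.toAddSubgroup) : x * y ∈ pColon p (s + t) L.toAddSubgroup := by
  rw [mem_pColon] at *
  have := L.mul_mem hx hy
  rw [pow_add, mul_mul_mul_comm]
  exact this

theorem HasPRank.jump_lt_jump_condGroup (hR : HasPRank R p n) {L : Subring R} {e t : ℕ}
    (hL : L.toAddSubgroup.index ≠ 0)
    (h : IsPExponent p L.toAddSubgroup e) (ht : t < e) :
    jump p L.toAddSubgroup t < jump p (condGroup p L) t := by
  have := hR.finite_quot
  have h0 := h.condGroup_index_ne_zero hR
  have hlt : (redMap p (pColon p t (condGroup p L)) : Set (R ⧸ Ideal.span {(p : R)})) ⊂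
      (redMap p (pColon p t L.toAddSubgroup) : Set (R ⧸ Ideal.span {(p : R)})) := by
    refine ⟨?_, fun hsub => ?_⟩
    · rw [pColon_condGroup]
      exact AddSubgroup.map_mono (condIdeal_le_pColon L t)
    · have : (1 : R ⧸ Ideal.span {(p : R)}) ∈ redMap p (pColon p t (condGroup p L)) :=
        hsub ⟨1, one_mem_pColon L t, map_one (redMod R p)⟩
      rw [← condMod_toAddSubgroup] at this
      exact h.one_notMem_condMod ht this
  have h1 := Set.ncard_lt_ncard hlt (Set.toFinite _)
  simp only [← Nat.card_coe_set_eq, SetLike.coe_sort_coe] at h1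
  rw [hR.card_redMap hL, hR.card_redMap h0, Nat.pow_lt_pow_iff_right hR.prime.one_lt] at h1
  have h2 := hR.jump_le hL t
  have h3 := hR.jump_le h0 t
  omega

theorem HasPRank.sum_jump (hR : HasPRank R p n) {L : AddSubgroup R} {e : ℕ} {i : ℕ}
    (hL : L.index = p ^ i) (h : pColon p e L = ⊤) :
    ∑ t ∈ Finset.range e, jump p L t = i := by
  have h0 : L.index ≠ 0 := by rw [hL]; exact (pow_pos hR.prime.pos _).ne'
  have h1 := (hR.hasJumps h0 e).index
  rw [h, AddSubgroup.index_top, mul_one, hL] at h1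
  exact (Nat.pow_right_injective hR.prime.two_le h1).symm

theorem IsPExponent.condGroup_index (hR : HasPRank R p n) {L : Subring R} {e : ℕ}
    (h : IsPExponent p L.toAddSubgroup e) :
    (condGroup p L).index = p ^ ∑ t ∈ Finset.range e, jump p (condGroup p L) t := by
  rw [(hR.hasJumps (h.condGroup_index_ne_zero hR) e).index, pColon_condGroup,
    h.condIdeal_eq_top]
  simp

end Conductor

section Teichmuller

variable {R : Type*} [CommRing R] {p n : ℕ}

theorem HasPRank.charP (hR : HasPRank R p n) (hn : n ≠ 0) : CharP (R ⧸ Ideal.span {(p : R)}) p := by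
  have hp := hR.prime
  have : Nontrivial (R ⧸ Ideal.span {(p : R)}) := by
    have := hR.finite_quot
    rw [← Finite.one_lt_card_iff_nontrivial, hR.card]
    exact Nat.one_lt_pow hn hp.one_lt
  rw [CharP.charP_iff_prime_eq_zero hp]
  have : redMod R p (p : R) = 0 := redMod_eq_zero.2 ⟨1, mul_one _⟩
  rwa [map_natCast] at this

/-- The `p ^ e`-th power of a lift of `z`; it is well defined modulo `p ^ (e + 1)`. -/
noncomputable def teich (p e : ℕ) (z : R ⧸ Ideal.span {(p : R)}) : R :=
  (Function.surjInv (Ideal.Quotient.mk_surjective (I := Ideal.span {(p : R)})) z) ^ p ^ e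

theorem redMod_teich (e : ℕ) (z : R ⧸ Ideal.span {(p : R)}) :
    redMod R p (teich p e z) = z ^ p ^ e := by
  rw [teich, map_pow, Function.surjInv_eq (f := redMod R p)]

theorem pow_sub_teich (e : ℕ) (x : R) :
    ∃ y, x ^ p ^ e - teich p e (redMod R p x) = (p : R) ^ (e + 1) * y := by
  refine dvd_sub_pow_of_dvd_sub ?_ e
  rw [← Ideal.mem_span_singleton, ← Ideal.Quotient.eq]
  exact (Function.surjInv_eq (f := redMod R p) _ _).symm

theorem IsPExponent.teich_mem_pColon {L : Subring R} {e t : ℕ}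
    (h : IsPExponent p L.toAddSubgroup e) {x : R} (hx : x ^ p ^ e ∈ pColon p t L.toAddSubgroup) :
    teich p e (redMod R p x) ∈ pColon p t L.toAddSubgroup := by
  obtain ⟨y, hy⟩ := pow_sub_teich (p := p) e x
  have h1 : teich p e (redMod R p x) = x ^ p ^ e - (p : R) ^ (e + 1) * y := by rw [← hy]; ring
  rw [h1]
  refine (pColon p t L.toAddSubgroup).sub_mem hx (le_pColon t _ ?_)
  exact h.pow_mul_mem_of_le (Nat.le_succ e) y

theorem IsPExponent.teich_mem_of_condMod {L : Subring R} {e t : ℕ} (hp : p ≠ 0)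
    (h : IsPExponent p L.toAddSubgroup e) {z : R ⧸ Ideal.span {(p : R)}}
    (hz : z ∈ condMod p L t) : teich p e z ∈ pColon p t L.toAddSubgroup := by
  obtain ⟨x, hx, rfl⟩ := mem_condMod.1 hz
  refine h.teich_mem_pColon (condIdeal_le_pColon L t ?_)
  exact Ideal.pow_mem_of_mem _ hx _ (pow_pos (Nat.pos_of_ne_zero hp) _)

theorem IsPExponent.teich_mem {L : Subring R} {e : ℕ}
    (h : IsPExponent p L.toAddSubgroup e) {z : R ⧸ Ideal.span {(p : R)}}
    (hz : z ∈ redMap p L.toAddSubgroup) (t : ℕ) : teich p e z ∈ pColon p t L.toAddSubgroup := by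
  obtain ⟨x, hx, rfl⟩ := hz
  exact h.teich_mem_pColon (le_pColon t _ (L.pow_mem hx _))

theorem HasPRank.pow_succ_le_card (hR : HasPRank R p n)
    {D D' : AddSubgroup (R ⧸ Ideal.span {(p : R)})} (hDD' : D < D') {a : ℕ}
    (hD : p ^ a ≤ Nat.card D) : p ^ (a + 1) ≤ Nat.card D' := by
  have := hR.finite_quot
  obtain ⟨k, -, hk⟩ := (Nat.dvd_prime_pow hR.prime).1
    (hR.card ▸ AddSubgroup.card_addSubgroup_dvd_card D')
  have h1 := Set.ncard_lt_ncard (SetLike.coe_ssubset_coe.2 hDD') (Set.toFinite _)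
  simp only [← Nat.card_coe_set_eq, SetLike.coe_sort_coe] at h1
  rw [hk] at h1 ⊢
  have h2 := (Nat.pow_lt_pow_iff_right hR.prime.one_lt).1 (hD.trans_lt h1)
  exact Nat.pow_le_pow_right hR.prime.pos h2

theorem pow_p_pow_injective {A : Type*} [CommRing A] [IsReduced A] {p : ℕ} (hp : p.Prime)
    [CharP A p] (e : ℕ) : Function.Injective fun z : A => z ^ p ^ e := by
  have := Fact.mk hp
  intro x y hxy
  have h1 : (x - y) ^ p ^ e = 0 := by
    rw [sub_pow_char_pow, sub_eq_zero]; exact hxy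
  exact sub_eq_zero.1 (IsReduced.eq_zero _ ⟨_, h1⟩)

theorem HasPRank.ideal_le_redMap_teich (hR : HasPRank R p n) (hn : n ≠ 0)
    [IsReduced (R ⧸ Ideal.span {(p : R)})] (I : Ideal (R ⧸ Ideal.span {(p : R)})) (e : ℕ) :
    I.toAddSubgroup ≤ redMap p (AddSubgroup.closure (teich p e '' I)) := by
  have := hR.finite_quot
  have := hR.charP hn
  have hpos : 0 < p ^ e := pow_pos hR.prime.pos _
  let F : I → I := fun z => ⟨z.1 ^ p ^ e, Ideal.pow_mem_of_mem _ z.2 _ hpos⟩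
  have hF : Function.Injective F := fun x y hxy =>
    Subtype.ext (pow_p_pow_injective hR.prime e (congrArg Subtype.val hxy))
  have hS := Finite.surjective_of_injective hF
  intro z hz
  obtain ⟨y, hy⟩ := hS ⟨z, hz⟩
  refine ⟨teich p e y.1, AddSubgroup.subset_closure ⟨y.1, y.2, rfl⟩, ?_⟩
  exact (redMod_teich e y.1).trans (congrArg Subtype.val hy)

theorem HasPRank.card_redMap_teich_union_one (hR : HasPRank R p n) (hn : n ≠ 0)
    [IsReduced (R ⧸ Ideal.span {(p : R)})] {I : Ideal (R ⧸ Ideal.span {(p : R)})} (e : ℕ)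
    (hI : 1 ∉ I) {a : ℕ} (ha : p ^ a ≤ Nat.card I) :
    p ^ (a + 1) ≤ Nat.card (redMap p (AddSubgroup.closure (teich p e '' I ∪ {(1 : R)}))) := by
  refine hR.pow_succ_le_card (D := I.toAddSubgroup) ?_ ha
  refine lt_of_le_of_ne ((hR.ideal_le_redMap_teich hn I e).trans
    (AddSubgroup.map_mono (AddSubgroup.closure_mono Set.subset_union_left))) fun h => hI ?_
  have : (1 : R ⧸ Ideal.span {(p : R)}) ∈
      redMap p (AddSubgroup.closure (teich p e '' I ∪ {(1 : R)})) :=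
    ⟨1, AddSubgroup.subset_closure (Or.inr rfl), map_one (redMod R p)⟩
  rw [← h] at this
  exact this

theorem HasPRank.card_zmultiples_one (hR : HasPRank R p n) (hn : n ≠ 0) :
    Nat.card (AddSubgroup.zmultiples (1 : R ⧸ Ideal.span {(p : R)})) = p := by
  have := hR.charP hn
  rw [Nat.card_zmultiples]
  exact CharP.eq _ (CharP.addOrderOf_one _) inferInstance

theorem HasPRank.card_redMap_closure_one (hR : HasPRank R p n) (hn : n ≠ 0) :
    Nat.card (redMap p (AddSubgroup.closure {(1 : R)})) = p := by
  rw [redMap, AddMonoidHom.map_closure, Set.image_singleton]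
  change Nat.card (AddSubgroup.closure {redMod R p 1}) = p
  rw [map_one, ← AddSubgroup.zmultiples_eq_closure]
  exact hR.card_zmultiples_one hn

theorem pow_mem_zmultiples_one {A : Type*} [CommRing A] [IsReduced A] {p : ℕ} (hp : p.Prime)
    [CharP A p] (e : ℕ) {z : A} (hz : z ^ p ^ e ∈ AddSubgroup.zmultiples (1 : A)) :
    z ∈ AddSubgroup.zmultiples (1 : A) := by
  have := Fact.mk hp
  obtain ⟨m, hm⟩ := AddSubgroup.mem_zmultiples_iff.1 hz
  rw [zsmul_one] at hm
  refine AddSubgroup.mem_zmultiples_iff.2 ⟨m, ?_⟩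
  rw [zsmul_one]
  apply pow_p_pow_injective hp e
  change (m : A) ^ p ^ e = z ^ p ^ e
  rw [← hm]
  have h1 : ((m : ZMod p) ^ p ^ e) = (m : ZMod p) := ZMod.pow_card_pow _
  have h2 := congrArg (ZMod.castHom dvd_rfl A) h1
  rwa [map_pow, map_intCast] at h2

theorem HasPRank.card_redMap_pair (hR : HasPRank R p n) (hn : n ≠ 0)
    [IsReduced (R ⧸ Ideal.span {(p : R)})] (e : ℕ) {z : R ⧸ Ideal.span {(p : R)}}
    (hz : z ∉ AddSubgroup.zmultiples (1 : R ⧸ Ideal.span {(p : R)})) :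
    p ^ 2 ≤ Nat.card (redMap p (AddSubgroup.closure {1, teich p e z})) := by
  have := hR.charP hn
  refine hR.pow_succ_le_card (D := redMap p (AddSubgroup.closure {(1 : R)})) (a := 1) ?_
    (by rw [pow_one, hR.card_redMap_closure_one hn])
  refine lt_of_le_of_ne (AddSubgroup.map_mono (AddSubgroup.closure_mono (by simp))) fun h => hz ?_
  apply pow_mem_zmultiples_one hR.prime e
  have h1 : redMod R p (teich p e z) ∈ redMap p (AddSubgroup.closure {1, teich p e z}) :=
    ⟨_, AddSubgroup.subset_closure (by simp), rfl⟩
  rw [← h, redMod_teich, redMap, AddMonoidHom.map_closure, Set.image_singleton] at h1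
  rw [AddSubgroup.zmultiples_eq_closure]
  have h2 : (redMod R p).toAddMonoidHom 1 = 1 := map_one (redMod R p)
  rwa [h2] at h1

end Teichmuller

section FiniteReduced

variable {A : Type*} [CommRing A] [Finite A] [IsReduced A] {p n : ℕ}

theorem exists_pow_eq_self (hp : p.Prime) [CharP A p] (x : A) : ∃ N, 2 ≤ N ∧ x ^ N = x := by
  obtain ⟨a, b, hab, h⟩ := Finite.exists_ne_map_eq_of_infinite fun e : ℕ => x ^ p ^ e
  wlog hlt : a < b generalizing a b
  · exact this b a hab.symm h.symm (by omega)
  obtain ⟨k, rfl⟩ := Nat.exists_eq_add_of_lt hlt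
  refine ⟨p ^ (k + 1), hp.two_le.trans (Nat.le_self_pow (by omega) p), ?_⟩
  apply pow_p_pow_injective hp a
  change (x ^ p ^ (k + 1)) ^ p ^ a = x ^ p ^ a
  rw [← pow_mul, ← pow_add]
  have h' : x ^ p ^ a = x ^ p ^ (a + k + 1) := h
  rw [h']
  congr 2
  ring

theorem card_maximalSpectrum_le (hp : p.Prime) (hA : Nat.card A = p ^ n) :
    Nat.card (MaximalSpectrum A) ≤ n := by
  classical
  let _ := Fintype.ofFinite (MaximalSpectrum A)
  have h1 := Nat.card_congr (IsArtinianRing.equivPi A).toEquiv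
  rw [Nat.card_pi, hA] at h1
  have h2 (m : MaximalSpectrum A) : p ≤ Nat.card (A ⧸ m.asIdeal) := by
    have hd : Nat.card (A ⧸ m.asIdeal) ∣ p ^ n :=
      hA ▸ AddSubgroup.card_quotient_dvd_card m.asIdeal.toAddSubgroup
    obtain ⟨k, -, hk⟩ := (Nat.dvd_prime_pow hp).1 hd
    have := m.isMaximal
    have : Nontrivial (A ⧸ m.asIdeal) := Ideal.Quotient.nontrivial_iff.2 m.isMaximal.ne_top
    have : Finite (A ⧸ m.asIdeal) := Finite.of_surjective _ Ideal.Quotient.mk_surjective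
    have h3 := Finite.one_lt_card (α := A ⧸ m.asIdeal)
    rw [hk] at h3 ⊢
    refine Nat.le_self_pow ?_ p
    rintro rfl
    simp at h3
  have h3 : p ^ Nat.card (MaximalSpectrum A) ≤ p ^ n := by
    rw [h1, Nat.card_eq_fintype_card, ← Finset.card_univ, ← Finset.prod_const]
    exact Finset.prod_le_prod' fun m _ => h2 m
  exact (Nat.pow_le_pow_iff_right hp.one_lt).1 h3

theorem card_ideal_le (hp : p.Prime) [CharP A p] (hA : Nat.card A = p ^ n) :
    Nat.card (Ideal A) ≤ 2 ^ n := by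
  classical
  let F (I : Ideal A) : Set (MaximalSpectrum A) := {m | I ≤ m.asIdeal}
  have hrad (I : Ideal A) : I.radical = I := by
    refine le_antisymm (fun x hx => ?_) Ideal.le_radical
    obtain ⟨k, hk⟩ := hx
    obtain ⟨N, hN, hxN⟩ := exists_pow_eq_self hp x
    have h1 : ∀ j, x ^ N ^ j = x := by
      intro j
      induction j with
      | zero => simp
      | succ j ih => rw [pow_succ, pow_mul, ih, hxN]
    rw [← h1 k]
    exact I.pow_mem_of_pow_mem hk (Nat.lt_pow_self (by omega)).le
  have hF : Function.Injective F := by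
    have key (I J : Ideal A) (h : F I = F J) : I ≤ J := by
      rw [← hrad J, Ideal.radical_eq_sInf]
      refine le_sInf fun P hP => ?_
      have := hP.2
      have : (⟨P, inferInstance⟩ : MaximalSpectrum A) ∈ F J := hP.1
      rw [← h] at this
      exact this
    exact fun I J h => le_antisymm (key I J h) (key J I h.symm)
  refine (Nat.card_le_card_of_injective F hF).trans ?_
  let _ := Fintype.ofFinite (MaximalSpectrum A)
  rw [Nat.card_eq_fintype_card, Fintype.card_set, ← Nat.card_eq_fintype_card]
  exact Nat.pow_le_pow_right (by norm_num) (card_maximalSpectrum_le hp hA)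

theorem encard_roots_le (hp : p.Prime) [CharP A p] (hA : Nat.card A = p ^ n)
    {f : Polynomial (ZMod p)} (hf : f.Monic) (hf1 : 1 ≤ f.natDegree) :
    {z : A | f.eval₂ (ZMod.castHom dvd_rfl A) z = 0}.encard ≤ (f.natDegree ^ n : ℕ) := by
  classical
  let _ := Fintype.ofFinite (MaximalSpectrum A)
  have hfld (m : MaximalSpectrum A) : IsDomain (A ⧸ m.asIdeal) :=
    have := m.isMaximal; inferInstance
  let φ (m : MaximalSpectrum A) : ZMod p →+* A ⧸ m.asIdeal :=
    (Ideal.Quotient.mk m.asIdeal).comp (ZMod.castHom dvd_rfl A)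
  let T : Finset (∀ m : MaximalSpectrum A, A ⧸ m.asIdeal) :=
    Fintype.piFinset fun m => (f.map (φ m)).roots.toFinset
  have hT : T.card ≤ f.natDegree ^ n := by
    rw [Fintype.card_piFinset]
    calc ∏ m, ((f.map (φ m)).roots.toFinset).card
        ≤ ∏ _m : MaximalSpectrum A, f.natDegree := by
          refine Finset.prod_le_prod' fun m _ => ?_
          exact (Multiset.toFinset_card_le _).trans
            ((Polynomial.card_roots' _).trans Polynomial.natDegree_map_le)
      _ = f.natDegree ^ Nat.card (MaximalSpectrum A) := by
          rw [Finset.prod_const, Finset.card_univ, Nat.card_eq_fintype_card]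
      _ ≤ f.natDegree ^ n := Nat.pow_le_pow_right hf1 (card_maximalSpectrum_le hp hA)
  refine le_trans ?_ (Nat.cast_le.2 hT)
  rw [← Set.encard_coe_eq_coe_finsetCard]
  refine Set.encard_le_encard_of_injOn (f := IsArtinianRing.equivPi A) (fun z hz => ?_)
    (IsArtinianRing.equivPi A).injective.injOn
  simp only [T, Finset.mem_coe, Fintype.mem_piFinset, Multiset.mem_toFinset]
  intro m
  rw [Polynomial.mem_roots (hf.map _).ne_zero, Polynomial.IsRoot.def, Polynomial.eval_map,
    IsArtinianRing.equivPi_apply]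
  have := congrArg (Ideal.Quotient.mk m.asIdeal) hz
  rw [Polynomial.hom_eval₂, map_zero] at this
  exact this

theorem exists_ringHom_galoisField {k : Type*} [Field k] [Fact p.Prime] [CharP k p]
    {g : ℕ} (hk : Nat.card k = p ^ g) : Nonempty (GaloisField p g →+* k) := by
  let _ : Algebra (ZMod p) k := ZMod.algebra k p
  exact ⟨(GaloisField.algEquivGaloisField p g hk).symm.toRingEquiv.toRingHom⟩

/-- A bounded set of elements outside the prime field which meets every subring other than the
prime field. -/
theorem exists_bounded_hitting_set (hp : p.Prime) [CharP A p] (hA : Nat.card A = p ^ n)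
    (hn : 2 ≤ n) :
    ∃ Z : Set A, Z.encard ≤ ((n + 1) * n ^ n : ℕ) ∧ (∀ z ∈ Z, z ∉ AddSubgroup.zmultiples (1 : A)) ∧
      ∀ V : Subring A, ¬ V.toAddSubgroup ≤ AddSubgroup.zmultiples (1 : A) → ∃ z ∈ Z, z ∈ V := by
  classical
  have := Fact.mk hp
  have hgen (g : ℕ) (hg : 2 ≤ g) : ∃ f : Polynomial (ZMod p), f.Monic ∧ 1 ≤ f.natDegree ∧
      f.natDegree ≤ g ∧ ∃ α : GaloisField p g, α ∉ AddSubgroup.zmultiples (1 : GaloisField p g) ∧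
        f.eval₂ (algebraMap (ZMod p) _) α = 0 := by
    have hg0 : g ≠ 0 := by omega
    have hex : ∃ α : GaloisField p g, α ∉ AddSubgroup.zmultiples (1 : GaloisField p g) := by
      by_contra! hcon
      have h1 : AddSubgroup.zmultiples (1 : GaloisField p g) = ⊤ := by
        rw [eq_top_iff]; exact fun x _ => hcon x
      have h2 : Nat.card (AddSubgroup.zmultiples (1 : GaloisField p g)) = p := by
        rw [Nat.card_zmultiples]
        exact CharP.eq _ (CharP.addOrderOf_one _) inferInstance
      rw [h1, AddSubgroup.card_top, GaloisField.card p g hg0] at h2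
      have := Nat.pow_right_injective hp.two_le (h2.trans (pow_one p).symm)
      omega
    obtain ⟨α, hα⟩ := hex
    have hint : IsIntegral (ZMod p) α := IsIntegral.of_finite _ _
    refine ⟨minpoly (ZMod p) α, minpoly.monic hint, minpoly.natDegree_pos hint, ?_, α, hα,
      minpoly.aeval _ _⟩
    exact (minpoly.natDegree_le α).trans (GaloisField.finrank p hg0).le
  choose! f hmon hdeg1 hdeg α hα hroot using hgen
  let f' (g : ℕ) : Polynomial (ZMod p) := if g < 2 then Polynomial.X ^ 2 - Polynomial.X else f g
  have hXX : (Polynomial.X ^ 2 - Polynomial.X : Polynomial (ZMod p)).Monic ∧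
      (Polynomial.X ^ 2 - Polynomial.X : Polynomial (ZMod p)).natDegree = 2 := by
    constructor
    · monicity!
    · compute_degree!
  have hf' (g : ℕ) (hg : g ≤ n) : (f' g).Monic ∧ 1 ≤ (f' g).natDegree ∧ (f' g).natDegree ≤ n := by
    by_cases h : g < 2
    · simp only [f', h, if_true]
      exact ⟨hXX.1, by rw [hXX.2]; norm_num, by rw [hXX.2]; exact hn⟩
    · simp only [f', h, if_false]
      exact ⟨hmon g (by omega), hdeg1 g (by omega), (hdeg g (by omega)).trans hg⟩
  let W : Set A := ⋃ g ∈ Finset.range (n + 1), {z : A | (f' g).eval₂ (ZMod.castHom dvd_rfl A) z = 0}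
  have hW : W.encard ≤ ((n + 1) * n ^ n : ℕ) := by
    rw [mul_comm]
    choose! G hG using fun (z : A) (hz : z ∈ W) => Set.mem_iUnion.1 hz
    refine Set.encard_le_mul_of_fibers G W (Finset.range (n + 1)) _ _ ?_
      (by rw [Set.encard_coe_eq_coe_finsetCard, Finset.card_range]) ?_
    · intro z hz
      obtain ⟨h1, -⟩ := Set.mem_iUnion.1 (hG z hz)
      exact h1
    · intro g hg
      have hgn : g ≤ n := by
        rw [Finset.mem_coe, Finset.mem_range] at hg; omega
      refine (Set.encard_le_encard (t := {z : A | (f' g).eval₂ (ZMod.castHom dvd_rfl A) z = 0})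
        ?_).trans ((encard_roots_le hp hA (hf' g hgn).1 (hf' g hgn).2.1).trans
          (Nat.cast_le.2 (Nat.pow_le_pow_left (hf' g hgn).2.2 n)))
      rintro z ⟨hz, rfl⟩
      obtain ⟨-, h2⟩ := Set.mem_iUnion.1 (hG z hz)
      exact h2
  refine ⟨W \ (AddSubgroup.zmultiples (1 : A) : Set A),
    (Set.encard_le_encard Set.sdiff_subset).trans hW, fun z hz => hz.2, fun V hV => ?_⟩
  have hmemW (g : ℕ) (hg : g ≤ n) (z : A) (hz : (f' g).eval₂ (ZMod.castHom dvd_rfl A) z = 0) :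
      z ∈ W := Set.mem_iUnion.2 ⟨g, Set.mem_iUnion.2 ⟨Finset.mem_range.2 (by omega), hz⟩⟩
  have hcharV : CharP V p := CharP.subring' A p V
  have hnt : Nontrivial A := CharP.nontrivial_of_char_ne_one hp.ne_one
  by_cases hfield : IsField V
  · obtain ⟨g, hgn, hg⟩ := (Nat.dvd_prime_pow hp).1
      (hA ▸ AddSubgroup.card_addSubgroup_dvd_card V.toAddSubgroup)
    have hone : AddSubgroup.zmultiples (1 : A) ≤ V.toAddSubgroup := by
      rw [AddSubgroup.zmultiples_le]; exact V.one_mem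
    have hcard1 : Nat.card (AddSubgroup.zmultiples (1 : A)) = p := by
      rw [Nat.card_zmultiples]
      exact CharP.eq _ (CharP.addOrderOf_one _) inferInstance
    have hg2 : 2 ≤ g := by
      by_contra! hlt
      apply hV
      have hle : Nat.card V.toAddSubgroup ≤ Nat.card (AddSubgroup.zmultiples (1 : A)) := by
        rw [hg, hcard1]
        calc p ^ g ≤ p ^ 1 := Nat.pow_le_pow_right hp.pos (by omega)
          _ = p := pow_one p
      exact (AddSubgroup.eq_of_le_of_card_ge hone hle).ge
    obtain ⟨φ⟩ := @exists_ringHom_galoisField p V hfield.toField _ hcharV g hg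
    let ψ : GaloisField p g →+* A := V.subtype.comp φ
    have hψ : ψ.comp (algebraMap (ZMod p) _) = ZMod.castHom dvd_rfl A := Subsingleton.elim _ _
    refine ⟨ψ (α g), ⟨hmemW g hgn _ ?_, fun hmem => ?_⟩, (φ (α g)).2⟩
    · have h1 := congrArg ψ (hroot g hg2)
      rw [Polynomial.hom_eval₂, map_zero, hψ] at h1
      simp only [f', if_neg (show ¬ g < 2 by omega)]
      exact h1
    · apply hα g hg2
      obtain ⟨m, hm⟩ := AddSubgroup.mem_zmultiples_iff.1 hmem
      refine AddSubgroup.mem_zmultiples_iff.2 ⟨m, ψ.injective ?_⟩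
      rw [map_zsmul, map_one, hm]
  · have hntV : Nontrivial V := inferInstance
    have : ∃ x : V, x ≠ 0 ∧ ¬ IsUnit x := by
      by_contra! hcon
      exact hfield ⟨⟨0, 1, zero_ne_one⟩, mul_comm, fun {a} ha => (hcon a ha).exists_right_inv⟩
    obtain ⟨x, hx0, hxu⟩ := this
    have hredV : IsReduced V := isReduced_of_injective V.subtype V.subtype_injective
    obtain ⟨N, hN, hxN⟩ := exists_pow_eq_self hp x
    obtain ⟨k, rfl⟩ := Nat.exists_eq_add_of_le hN
    set ε : V := x ^ (k + 1) with hε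
    have hεx : ε * x = x := by rw [hε, ← pow_succ]; convert hxN using 2; ring
    have hεε : ε ^ 2 = ε := by
      rw [sq]; nth_rewrite 2 [hε]; rw [pow_succ', ← mul_assoc, hεx, ← pow_succ']
    have hε0 : ε ≠ 0 := fun h0 => hx0 (by rw [← hεx, h0, zero_mul])
    have hε1 : ε ≠ 1 := fun h1 => hxu (IsUnit.of_mul_eq_one (x ^ k) (by
      rw [← pow_succ']; exact h1))
    refine ⟨ε, ⟨hmemW 0 (Nat.zero_le _) _ ?_, fun hmem => ?_⟩, ε.2⟩
    · have : ((ε : A)) ^ 2 = ε := by exact_mod_cast congrArg Subtype.val hεε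
      simp [f', this]
    · obtain ⟨m, hm⟩ := AddSubgroup.mem_zmultiples_iff.1 hmem
      rw [zsmul_one] at hm
      have hm' : ε = (m : V) := Subtype.ext (by rw [← hm]; simp)
      have h2 : ((m : ZMod p)) ^ 2 = m := by
        have h3 : (ZMod.castHom dvd_rfl V) ((m : ZMod p) ^ 2) = (ZMod.castHom dvd_rfl V) m := by
          rw [map_pow, map_intCast, ← hm', hεε]
        exact (ZMod.castHom dvd_rfl V).injective h3
      have h4 : (m : ZMod p) * ((m : ZMod p) - 1) = 0 := by linear_combination h2
      rcases mul_eq_zero.1 h4 with h5 | h5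
      · apply hε0
        rw [hm', ← map_intCast (ZMod.castHom dvd_rfl V), h5, map_zero]
      · apply hε1
        rw [hm', ← map_intCast (ZMod.castHom dvd_rfl V), sub_eq_zero.1 h5, map_one]

end FiniteReduced

section Duality

variable {R : Type*} [CommRing R] {p n : ℕ}

/-- A family of fewer than `p` nonzero elements of a finite abelian `p`-group is separated from
zero by a single character. -/
theorem exists_addChar_ne_one {Q ι : Type*} [AddCommGroup Q] [Finite Q] [Finite ι] {i : ℕ}
    (hp : p.Prime) (hQ : Nat.card Q = p ^ i) (hι : Nat.card ι < p) (x : ι → Q)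
    (hx : ∀ m, x m ≠ 0) : ∃ ψ : AddChar Q ℂ, ∀ m, ψ (x m) ≠ 1 := by
  classical
  let _ := Fintype.ofFinite ι
  let _ := Fintype.ofFinite Q
  let _ := Fintype.ofFinite (AddChar Q ℂ)
  by_contra! hcon
  let E (m : ι) : AddSubgroup (AddChar Q ℂ) :=
    { carrier := {ψ | ψ (x m) = 1}
      zero_mem' := by simp
      add_mem' := by
        intro a b ha hb
        simp only [Set.mem_ofPred_eq] at *
        rw [AddChar.add_apply, ha, hb, one_mul]
      neg_mem' := by
        intro a ha
        simp only [Set.mem_ofPred_eq] at *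
        rw [AddChar.neg_apply, AddChar.map_neg_eq_inv, ha, inv_one] }
  have hD : Nat.card (AddChar Q ℂ) = p ^ i := by
    rw [← hQ, Nat.card_eq_fintype_card, Nat.card_eq_fintype_card, AddChar.card_eq]
  have hE (m : ι) : Nat.card (E m) * p ≤ p ^ i := by
    have h1 := AddSubgroup.card_mul_index (E m)
    rw [hD] at h1
    rw [← h1]
    refine Nat.mul_le_mul_left _ ?_
    obtain ⟨k, -, hk⟩ := (Nat.dvd_prime_pow hp).1 (Dvd.intro_left _ h1)
    rw [hk]
    refine Nat.le_self_pow ?_ p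
    rintro rfl
    rw [pow_zero, AddSubgroup.index_eq_one] at hk
    obtain ⟨ψ, hψ⟩ := AddChar.exists_apply_ne_zero.2 (hx m)
    have : ψ ∈ E m := by rw [hk]; trivial
    exact hψ this
  have hcover : (Finset.univ : Finset (AddChar Q ℂ)) ⊆
      Finset.univ.biUnion fun m => Finset.univ.filter (· ∈ E m) := by
    intro ψ _
    obtain ⟨m, hm⟩ := hcon ψ
    simp only [Finset.mem_biUnion, Finset.mem_filter, Finset.mem_univ, true_and]
    exact ⟨m, hm⟩
  have h1 := (Finset.card_le_card hcover).trans Finset.card_biUnion_le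
  have h2 (m : ι) : (Finset.univ.filter (· ∈ E m)).card = Nat.card (E m) := by
    rw [Nat.card_eq_fintype_card, Fintype.card_subtype]
  rw [Finset.card_univ, ← Nat.card_eq_fintype_card, hD, Finset.sum_congr rfl fun m _ => h2 m] at h1
  have h3 : p ^ i * p ≤ Nat.card ι * p ^ i := by
    calc p ^ i * p ≤ (∑ m, Nat.card (E m)) * p := Nat.mul_le_mul_right _ h1
      _ = ∑ m, Nat.card (E m) * p := Finset.sum_mul _ _ _
      _ ≤ ∑ _m : ι, p ^ i := Finset.sum_le_sum fun m _ => hE m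
      _ = Nat.card ι * p ^ i := by rw [Finset.sum_const, Nat.card_eq_fintype_card]; rfl
  rw [mul_comm] at h3
  have := Nat.le_of_mul_le_mul_right h3 (pow_pos hp.pos i)
  omega

theorem condIdeal_zero_mem_of_le {L : Subring R} {I : Ideal R} (h : ∀ x ∈ I, x ∈ L) :
    I ≤ condIdeal p L 0 := by
  intro x hx r
  rw [pow_zero, one_mul]
  exact h _ (I.mul_mem_right r hx)

theorem mem_of_mem_condIdeal_zero {L : Subring R} {x : R} (hx : x ∈ condIdeal p L 0) : x ∈ L := by
  simpa using hx 1

/-- The characters of `R / L` attached to the elements of `L`. -/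
theorem relIndex_condGroup_le_of_addChar {L : Subring R} [Finite (R ⧸ L.toAddSubgroup)]
    (ψ : AddChar (R ⧸ L.toAddSubgroup) ℂ)
    (hψ : ∀ x : R, (∀ r : R, ψ (QuotientAddGroup.mk (x * r)) = 1) → x ∈ condIdeal p L 0) :
    (condGroup p L).relIndex L.toAddSubgroup ≤ L.toAddSubgroup.index := by
  classical
  let _ := Fintype.ofFinite (R ⧸ L.toAddSubgroup)
  have hm (x : L.toAddSubgroup) :
      L.toAddSubgroup ≤ L.toAddSubgroup.comap (AddMonoidHom.mulLeft (x : R)) :=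
    fun r hr => L.mul_mem x.2 hr
  let m (x : L.toAddSubgroup) : R ⧸ L.toAddSubgroup →+ R ⧸ L.toAddSubgroup :=
    QuotientAddGroup.map _ _ (AddMonoidHom.mulLeft (x : R)) (hm x)
  have hmr (x : L.toAddSubgroup) (r : R) :
      m x (QuotientAddGroup.mk r) = QuotientAddGroup.mk ((x : R) * r) := rfl
  let Φ : L.toAddSubgroup →+ AddChar (R ⧸ L.toAddSubgroup) ℂ := AddMonoidHom.mk'
    (fun x => ψ.compAddMonoidHom (m x)) (fun x y => by
      ext q
      obtain ⟨r, rfl⟩ := QuotientAddGroup.mk_surjective q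
      rw [AddChar.add_apply, AddChar.compAddMonoidHom_apply, AddChar.compAddMonoidHom_apply,
        AddChar.compAddMonoidHom_apply, ← AddChar.map_add_eq_mul, hmr, hmr, hmr,
        ← QuotientAddGroup.mk_add, ← add_mul]
      rfl)
  have hker : Φ.ker ≤ (condGroup p L).addSubgroupOf L.toAddSubgroup := by
    intro x hx
    refine hψ x fun r => ?_
    have := DFunLike.congr_fun (AddMonoidHom.mem_ker.1 hx) (QuotientAddGroup.mk r)
    exact this
  have h1 : Φ.ker.index = Nat.card Φ.range := AddSubgroup.index_ker Φ
  have hpos : 0 < Φ.ker.index := by rw [h1]; exact Nat.card_pos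
  refine (Nat.le_of_dvd hpos (AddSubgroup.index_dvd_of_le hker)).trans ?_
  rw [h1, AddSubgroup.index_eq_card]
  refine (Nat.card_le_card_of_injective Subtype.val Subtype.val_injective).trans ?_
  rw [Nat.card_eq_fintype_card, Nat.card_eq_fintype_card, AddChar.card_eq]

theorem comap_map_redMod_of_mem {M : Ideal R} (hM : M.IsMaximal) (hpM : (p : R) ∈ M) :
    (M.map (redMod R p)).comap (redMod R p) = M ∧ (M.map (redMod R p)).IsMaximal := by
  have hker : Ideal.span {(p : R)} ≤ M := by
    rw [Ideal.span_le]; simpa using hpM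
  have hcm : (M.map (redMod R p)).comap (redMod R p) = M := by
    rw [Ideal.comap_map_of_surjective _ Ideal.Quotient.mk_surjective, sup_eq_left]
    intro y hy
    have : redMod R p y = 0 := hy
    exact hker (Ideal.Quotient.eq_zero_iff_mem.1 this)
  refine ⟨hcm, (Ideal.map_eq_top_or_isMaximal_of_surjective _ Ideal.Quotient.mk_surjective
    hM).resolve_left fun h => hM.ne_top ?_⟩
  rw [← hcm, h, Ideal.comap_top]

theorem HasPRank.condGroup_index_le (hR : HasPRank R p n) [IsDedekindDomain R]
    [IsReduced (R ⧸ Ideal.span {(p : R)})] (hnp : n < p) {L : Subring R} {e i : ℕ}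
    (hL : L.toAddSubgroup.index = p ^ i) (he : IsPExponent p L.toAddSubgroup e) :
    (condGroup p L).index ≤ L.toAddSubgroup.index ^ 2 := by
  classical
  have hLpos : 0 < L.toAddSubgroup.index := by rw [hL]; exact pow_pos hR.prime.pos _
  have hfinA := hR.finite_quot
  set f := condIdeal p L 0 with hf
  by_cases htop : f = ⊤
  · have : (condGroup p L).index = 1 := by
      rw [AddSubgroup.index_eq_one, condGroup, ← hf, htop]; rfl
    rw [this]
    exact Nat.one_le_pow _ _ hLpos
  have hf0 : f ≠ ⊥ := by
    intro h0
    have h1 : (p : R) ^ e ∈ f := by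
      intro r
      rw [pow_zero, one_mul]
      exact he.pow_mul_mem r
    rw [h0, Ideal.mem_bot] at h1
    have h2 : (p : R) = 0 := by
      by_contra h2
      exact pow_ne_zero e h2 h1
    have := hR.inj (show (fun x : R => (p : R) * x) 1 = (fun x : R => (p : R) * x) 0 by simp [h2])
    exact one_ne_zero this
  have hquot : Finite (R ⧸ L.toAddSubgroup) :=
    Nat.finite_of_card_ne_zero (by rw [← AddSubgroup.index_eq_card]; exact hLpos.ne')
  let P (m : MaximalSpectrum (R ⧸ Ideal.span {(p : R)})) : Ideal R := m.asIdeal.comap (redMod R p)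
  let g (m : MaximalSpectrum (R ⧸ Ideal.span {(p : R)})) : Ideal R :=
    if h : ∃ I, f = P m * I then h.choose else ⊤
  have hg (m) : ∃ x ∈ g m, x ∉ L := by
    by_contra! hcon
    have h1 : g m ≤ f := condIdeal_zero_mem_of_le hcon
    by_cases h : ∃ I, f = P m * I
    · have h2 : f = P m * g m := by simp only [g, dif_pos h]; exact h.choose_spec
      have h3 : f = g m := le_antisymm (h2.le.trans Ideal.mul_le_right) h1
      rw [← h3] at h2
      have h4 : P m = 1 := by
        have : P m * f = 1 * f := by rw [one_mul]; exact h2.symm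
        exact mul_right_cancel₀ hf0 this
      have h5 := m.isMaximal.ne_top
      rw [Ideal.one_eq_top] at h4
      exact h5 (by rw [Ideal.eq_top_iff_one] at h4 ⊢; simpa [P] using h4)
    · simp only [g, dif_neg h] at h1
      exact htop (top_le_iff.1 h1)
  choose x hxg hxL using hg
  obtain ⟨ψ, hψ⟩ := exists_addChar_ne_one hR.prime
    (Q := R ⧸ L.toAddSubgroup) (by rw [← AddSubgroup.index_eq_card, hL])
    ((card_maximalSpectrum_le hR.prime hR.card).trans_lt hnp) (fun m => QuotientAddGroup.mk (x m))
    (fun m h0 => hxL m ((QuotientAddGroup.eq_zero_iff _).1 h0))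
  have hbig (I : Ideal R) (hI : f < I) : ∃ m, g m ≤ I := by
    obtain ⟨J, hJ⟩ := Ideal.dvd_iff_le.2 hI.le
    have hJ1 : J ≠ ⊤ := by
      rintro rfl
      rw [← Ideal.one_eq_top, mul_one] at hJ
      exact hI.ne hJ
    obtain ⟨M, hM, hJM⟩ := Ideal.exists_le_maximal J hJ1
    obtain ⟨J', hJ'⟩ := Ideal.dvd_iff_le.2 hJM
    have hpM : (p : R) ∈ M := by
      refine hM.isPrime.mem_of_pow_mem e (hJM ?_)
      have h1 : (p : R) ^ e ∈ f := by
        intro r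
        rw [pow_zero, one_mul]
        exact he.pow_mul_mem r
      rw [hJ] at h1
      exact Ideal.mul_le_right h1
    obtain ⟨hcm, hmax⟩ := comap_map_redMod_of_mem hM hpM
    refine ⟨⟨_, hmax⟩, ?_⟩
    have hPM : P ⟨_, hmax⟩ = M := hcm
    have hex : ∃ I', f = P ⟨_, hmax⟩ * I' := ⟨I * J', by rw [hPM, hJ, hJ']; ring⟩
    have h1 : f = P ⟨_, hmax⟩ * g ⟨_, hmax⟩ := by simp only [g, dif_pos hex]; exact hex.choose_spec
    have h2 : M * g ⟨_, hmax⟩ = M * (I * J') := by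
      rw [hPM] at h1
      rw [← h1, hJ, hJ']; ring
    have hM0 : M ≠ 0 := by
      rintro rfl
      apply hf0
      rw [hJ, hJ', zero_mul, mul_zero]; rfl
    rw [mul_left_cancel₀ hM0 h2]
    exact Ideal.mul_le_left
  have key := relIndex_condGroup_le_of_addChar (p := p) ψ (fun y hy => by
    by_contra hyf
    have hlt : f < f ⊔ Ideal.span {y} := by
      refine lt_of_le_of_ne le_sup_left fun h => hyf ?_
      rw [← hf, h]
      exact (le_sup_right : _ ≤ f ⊔ Ideal.span {y}) (Ideal.mem_span_singleton_self y)
    obtain ⟨m, hm⟩ := hbig _ hlt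
    apply hψ m
    obtain ⟨a, ha, b, hb, hab⟩ := Submodule.mem_sup.1 (hm (hxg m))
    obtain ⟨r, rfl⟩ := Ideal.mem_span_singleton.1 hb
    rw [← hab, QuotientAddGroup.mk_add, AddChar.map_add_eq_mul, hy r, mul_one]
    have : (QuotientAddGroup.mk a : R ⧸ L.toAddSubgroup) = 0 :=
      (QuotientAddGroup.eq_zero_iff _).2 (mem_of_mem_condIdeal_zero ha)
    rw [this, AddChar.map_zero_eq_one])
  rw [sq, ← AddSubgroup.relIndex_mul_index (show condGroup p L ≤ L.toAddSubgroup from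
    fun y hy => mem_of_mem_condIdeal_zero hy)]
  exact Nat.mul_le_mul_right _ key

end Duality

/-- `y` satisfies a monic quadratic equation with integer coefficients. -/
def IsQuadratic {A : Type*} [CommRing A] (y : A) : Prop := ∃ a b : ℤ, y ^ 2 = a + b * y

theorem intCast_eq_zero_or_exists_inv {A : Type*} [CommRing A] {p : ℕ} [CharP A p]
    (hp : p.Prime) (k : ℤ) : (k : A) = 0 ∨ ∃ l : ℤ, (l : A) * k = 1 := by
  by_cases h : (p : ℤ) ∣ k
  · exact Or.inl ((CharP.intCast_eq_zero_iff A p k).2 h)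
  · right
    have hc : IsCoprime (p : ℤ) k :=
      ((Nat.prime_iff_prime_int.1 hp).irreducible.coprime_iff_not_dvd).2 h
    obtain ⟨u, v, huv⟩ := hc
    refine ⟨v, ?_⟩
    have h1 := congrArg (Int.cast : ℤ → A) huv
    push_cast at h1
    rw [CharP.cast_eq_zero A p, mul_zero, zero_add] at h1
    exact h1

theorem not_isQuadratic_shift {A : Type*} [CommRing A] [IsReduced A] {p : ℕ} [CharP A p]
    (hp : p.Prime) (hp2 : p ≠ 2) {y z : A} (hyq : IsQuadratic y)
    (hy : ∀ a : ℤ, y ≠ a) (hz : ∀ a b : ℤ, z ≠ a + b * y) :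
    ¬ (IsQuadratic z ∧ IsQuadratic (z + y) ∧ IsQuadratic (z - y)) := by
  rintro ⟨⟨c, d, hzq⟩, ⟨r, s, h1⟩, ⟨r', s', h2⟩⟩
  obtain ⟨a, b, hyq⟩ := hyq
  obtain ⟨h, hh⟩ : ∃ h : ℤ, (h : A) * 2 = 1 := by
    rcases intCast_eq_zero_or_exists_inv (A := A) hp 2 with h | ⟨l, hl⟩
    · exfalso
      rw [CharP.intCast_eq_zero_iff A p] at h
      have : p ∣ 2 := by exact_mod_cast h
      exact hp2 ((Nat.prime_dvd_prime_iff_eq hp Nat.prime_two).1 this)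
    · exact ⟨l, by exact_mod_cast hl⟩
  have nz {k : ℤ} {x : A} {u : A} (hx : (k : A) * x = u) :
      (k : A) = 0 ∨ ∃ l : ℤ, x = l * u := by
    rcases intCast_eq_zero_or_exists_inv (A := A) hp k with h | ⟨l, hl⟩
    · exact Or.inl h
    · exact Or.inr ⟨l, by rw [← hx, ← mul_assoc, hl, one_mul]⟩
  -- the sum of the two relations expresses a multiple of `z` through `1` and `y`
  have e1 : ((s + s' - 2 * d : ℤ) : A) * z =
      ((2 * a + 2 * c - r - r' : ℤ) : A) + ((2 * b - s + s' : ℤ) : A) * y := by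
    push_cast
    linear_combination -h1 - h2 + 2 * hyq + 2 * hzq
  rcases nz e1 with h0 | ⟨l, hl⟩
  swap
  · exact hz (l * (2 * a + 2 * c - r - r')) (l * (2 * b - s + s'))
      (by rw [hl]; push_cast; ring)
  rw [h0, zero_mul] at e1
  have e2 : ((2 * b - s + s' : ℤ) : A) * y = ((-(2 * a + 2 * c - r - r') : ℤ) : A) := by
    push_cast at e1 ⊢
    linear_combination -e1
  rcases nz e2 with h3 | ⟨l, hl⟩
  swap
  · exact hy (l * (-(2 * a + 2 * c - r - r'))) (by rw [hl]; push_cast; ring)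
  push_cast at h0 h3
  -- hence `s = b + d`, and the product of the centred elements is an integer
  have hs : (s : A) = b + d := by
    linear_combination (h : A) * (h0 - h3) - (s - b - d : A) * hh
  have e3 : (2 * y - b) * (2 * z - d) = ((2 * (r - a - c) + b * d : ℤ) : A) := by
    push_cast
    linear_combination 2 * h1 - 2 * hyq - 2 * hzq + 2 * (z + y) * hs
  have e4 : (2 * y - b) ^ 2 = ((4 * a + b ^ 2 : ℤ) : A) := by
    push_cast
    linear_combination 4 * hyq
  generalize hq : (2 * (r - a - c) + b * d : ℤ) = q at e3
  generalize hβ : (4 * a + b ^ 2 : ℤ) = β at e4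
  have e5 : (β : A) * z = ((h * (β * d - q * b) : ℤ) : A) + (q : A) * y := by
    push_cast
    linear_combination (h : A) * ((2 * y - b) * e3 - (2 * z - d) * e4) +
      (q * y - β * z : A) * hh
  rcases nz e5 with h5 | ⟨l, hl⟩
  swap
  · exact hz (l * (h * (β * d - q * b))) (l * q) (by rw [hl]; push_cast; ring)
  rw [h5] at e4
  have e6 : 2 * y - b = 0 := pow_eq_zero_iff (two_ne_zero) |>.1 e4
  exact hy (h * b) (by push_cast; linear_combination (h : A) * e6 - y * hh)

theorem card_closure_le {A : Type*} [CommRing A] [Finite A] {p : ℕ} [CharP A p]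
    (hp : p.Prime) (y : A) :
    {z : A | ∃ a b : ℤ, z = a + b * y}.ncard ≤ p ^ 2 := by
  classical
  have hsub : {z : A | ∃ a b : ℤ, z = a + b * y} ⊆
      ((Finset.range p ×ˢ Finset.range p).image fun q : ℕ × ℕ =>
        (q.1 : A) + q.2 * y : Finset A) := by
    rintro z ⟨a, b, rfl⟩
    have red (k : ℤ) : ∃ m < p, (m : A) = k := by
      refine ⟨(k % p).toNat, ?_, ?_⟩
      · have := Int.emod_lt_of_pos k (Int.natCast_pos.2 hp.pos)
        have := hp.pos
        omega
      · have h0 := Int.emod_nonneg k (Int.natCast_ne_zero.2 hp.ne_zero)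
        rw [← Int.cast_natCast, Int.toNat_of_nonneg h0, CharP.intCast_eq_intCast A p]
        exact Int.mod_modEq k p
    obtain ⟨m, hm, hma⟩ := red a
    obtain ⟨m', hm', hmb⟩ := red b
    simp only [Finset.coe_image, Finset.coe_product, Set.mem_image, Set.mem_prod, Finset.mem_coe,
      Finset.mem_range, Prod.exists]
    exact ⟨m, m', ⟨hm, hm'⟩, by rw [hma, hmb]⟩
  refine (Set.ncard_le_ncard hsub (Set.toFinite _)).trans ?_
  rw [Set.ncard_coe_finset]
  refine Finset.card_image_le.trans ?_
  simp [sq]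

theorem card_le_six_mul_ncard_not_isQuadratic {A : Type*} [CommRing A] [IsReduced A] [Finite A]
    {p : ℕ} [CharP A p] (hp : p.Prime) (hp2 : p ≠ 2) (V : AddSubgroup A)
    (hV : p ^ 3 ≤ Nat.card V) :
    Nat.card V ≤ 6 * {y : A | y ∈ V ∧ ¬ IsQuadratic y}.ncard := by
  set G : Set A := {y : A | y ∈ V ∧ ¬ IsQuadratic y} with hG
  have hcard : Nat.card V = (V : Set A).ncard := rfl
  have h2p : 2 * p ^ 2 ≤ p ^ 3 := by
    rw [pow_succ p 2, mul_comm]; exact Nat.mul_le_mul_left _ hp.two_le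
  by_cases hb : ∃ y ∈ V, IsQuadratic y ∧ ∀ a : ℤ, y ≠ a
  · obtain ⟨y, hyV, hyq, hy⟩ := hb
    have hsub : (V : Set A) ⊆ {z : A | ∃ a b : ℤ, z = a + b * y} ∪
        (G ∪ ((fun x => x - y) '' G ∪ (fun x => x + y) '' G)) := by
      intro z hz
      by_cases hzy : ∃ a b : ℤ, z = a + b * y
      · exact Or.inl hzy
      · right
        push Not at hzy
        have := not_isQuadratic_shift hp hp2 hyq hy hzy
        by_cases h1 : IsQuadratic z
        · by_cases h2 : IsQuadratic (z + y)
          · exact Or.inr (Or.inr ⟨z - y, ⟨V.sub_mem hz hyV, fun h3 => this ⟨h1, h2, h3⟩⟩,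
              sub_add_cancel z y⟩)
          · exact Or.inr (Or.inl ⟨z + y, ⟨V.add_mem hz hyV, h2⟩, add_sub_cancel_right z y⟩)
        · exact Or.inl ⟨hz, h1⟩
    have h1 := Set.ncard_le_ncard hsub (Set.toFinite _)
    have h2 := Set.ncard_union_le {z : A | ∃ a b : ℤ, z = a + b * y}
      (G ∪ ((fun x => x - y) '' G ∪ (fun x => x + y) '' G))
    have h3 := Set.ncard_union_le G ((fun x => x - y) '' G ∪ (fun x => x + y) '' G)
    have h4 := Set.ncard_union_le ((fun x => x - y) '' G) ((fun x => x + y) '' G)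
    have h5 := Set.ncard_image_le (f := fun x => x - y) (Set.toFinite G)
    have h6 := Set.ncard_image_le (f := fun x => x + y) (Set.toFinite G)
    have h7 := card_closure_le hp y
    omega
  · push Not at hb
    have hsub : (V : Set A) ⊆ {z : A | ∃ a b : ℤ, z = a + b * (0 : A)} ∪ G := by
      intro z hz
      by_cases h1 : IsQuadratic z
      · obtain ⟨a, ha⟩ := hb z hz h1
        exact Or.inl ⟨a, 0, by simp [ha]⟩
      · exact Or.inr ⟨hz, h1⟩
    have h1 := Set.ncard_le_ncard hsub (Set.toFinite _)
    have h2 := Set.ncard_union_le {z : A | ∃ a b : ℤ, z = a + b * (0 : A)} G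
    have h7 := card_closure_le hp (0 : A)
    omega

theorem card_le_mul_ncard_preimage {Q A : Type*} [AddCommGroup Q] [Finite Q] [AddCommGroup A]
    (g : Q →+ A) (W : AddSubgroup Q) (P : A → Prop) (k : ℕ)
    (h : Nat.card (W.map g) ≤ k * {y : A | y ∈ W.map g ∧ P y}.ncard) :
    Nat.card W ≤ k * {w : Q | w ∈ W ∧ P (g w)}.ncard := by
  set f : W →+ A := g.comp W.subtype with hf
  have hrange : f.range = W.map g := by
    ext y; simp [hf, AddSubgroup.mem_map]
  have hW : Nat.card W = Nat.card (W.map g) * Nat.card f.ker := by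
    rw [AddSubgroup.card_eq_card_quotient_mul_card_addSubgroup f.ker, ← hrange,
      Nat.card_congr (QuotientAddGroup.quotientKerEquivRange f).toEquiv]
  choose! w hw hgw using fun (y : A) (hy : y ∈ {y : A | y ∈ W.map g ∧ P y}) =>
    AddSubgroup.mem_map.1 hy.1
  have hle : Nat.card ({y : A | y ∈ W.map g ∧ P y} × f.ker) ≤
      Nat.card {x : Q | x ∈ W ∧ P (g x)} := by
    refine Nat.card_le_card_of_injective
      (fun q => ⟨w q.1 + (q.2 : W), W.add_mem (hw _ q.1.2) (q.2 : W).2, ?_⟩) ?_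
    · have : g ((q.2 : W) : Q) = 0 := q.2.2
      rw [map_add, this, add_zero, hgw _ q.1.2]
      exact q.1.2.2
    · rintro ⟨⟨y, hy⟩, u⟩ ⟨⟨y', hy'⟩, u'⟩ heq
      simp only [Subtype.mk.injEq] at heq
      have hu : g ((u : W) : Q) = 0 := u.2
      have hu' : g ((u' : W) : Q) = 0 := u'.2
      have h1 := congrArg g heq
      rw [map_add, map_add, hu, hu', add_zero, add_zero, hgw _ hy, hgw _ hy'] at h1
      subst h1
      have h2 := add_left_cancel heq
      exact Prod.ext rfl (Subtype.ext (Subtype.ext h2))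
  rw [Nat.card_prod, Nat.card_coe_set_eq, Nat.card_coe_set_eq] at hle
  calc Nat.card W ≤ k * {y : A | y ∈ W.map g ∧ P y}.ncard * Nat.card f.ker := by
        rw [hW]; exact Nat.mul_le_mul_right _ h
    _ ≤ _ := by rw [mul_assoc]; exact Nat.mul_le_mul_left _ hle

section DoubleCount

variable {R : Type*} [CommRing R] {p n : ℕ}

theorem HasPRank.card_redMap_pair_of_not_isQuadratic (hR : HasPRank R p n) (hn : n ≠ 0) {y : R}
    (hy : ¬ IsQuadratic (redMod R p y)) :
    p ^ 2 ≤ Nat.card (redMap p (AddSubgroup.closure {1, y})) := by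
  refine hR.pow_succ_le_card (D := redMap p (AddSubgroup.closure {(1 : R)})) (a := 1) ?_
    (by rw [pow_one, hR.card_redMap_closure_one hn])
  refine lt_of_le_of_ne (AddSubgroup.map_mono (AddSubgroup.closure_mono (by simp))) fun h => hy ?_
  have h1 : redMod R p y ∈ redMap p (AddSubgroup.closure {1, y}) :=
    ⟨_, AddSubgroup.subset_closure (by simp), rfl⟩
  rw [← h] at h1
  obtain ⟨x, hx, hxy⟩ := h1
  obtain ⟨m, rfl⟩ := AddSubgroup.mem_closure_singleton.1 hx
  refine ⟨m ^ 2, 0, ?_⟩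
  have hxy' : redMod R p (m • (1 : R)) = redMod R p y := hxy
  rw [zsmul_one, map_intCast] at hxy'
  rw [← hxy']
  push_cast
  ring

theorem HasPRank.card_redMap_triple (hR : HasPRank R p n) (hn : n ≠ 0) {y : R}
    (hy : ¬ IsQuadratic (redMod R p y)) :
    p ^ 3 ≤ Nat.card (redMap p (AddSubgroup.closure {1, y, y ^ 2})) := by
  refine hR.pow_succ_le_card (D := redMap p (AddSubgroup.closure {1, y})) (a := 2) ?_
    (hR.card_redMap_pair_of_not_isQuadratic hn hy)
  refine lt_of_le_of_ne (AddSubgroup.map_mono (AddSubgroup.closure_mono ?_)) fun h => hy ?_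
  · intro x hx
    rcases hx with rfl | rfl <;> simp
  have h1 : redMod R p (y ^ 2) ∈ redMap p (AddSubgroup.closure {1, y, y ^ 2}) :=
    ⟨_, AddSubgroup.subset_closure (by simp), rfl⟩
  rw [← h] at h1
  obtain ⟨x, hx, hxy⟩ := h1
  obtain ⟨a, b, rfl⟩ := AddSubgroup.mem_closure_pair.1 hx
  have hxy' : redMod R p (a • (1 : R) + b • y) = redMod R p (y ^ 2) := hxy
  refine ⟨a, b, ?_⟩
  rw [map_pow] at hxy'
  rw [← hxy', zsmul_one, zsmul_eq_mul, map_add, map_mul, map_intCast, map_intCast]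

theorem mem_iterate_pMul {M : AddSubgroup R} (k : ℕ) {x : R} :
    x ∈ (pMul p)^[k] M ↔ ∃ y ∈ M, (p : R) ^ k * y = x := by
  induction k generalizing x with
  | zero => simp
  | succ k ih =>
    rw [Function.iterate_succ_apply', mem_pMul]
    constructor
    · rintro ⟨z, hz, rfl⟩
      obtain ⟨y, hy, rfl⟩ := ih.1 hz
      exact ⟨y, hy, by ring⟩
    · rintro ⟨y, hy, rfl⟩
      exact ⟨(p : R) ^ k * y, ih.2 ⟨y, hy, rfl⟩, by ring⟩

theorem HasPRank.index_iterate_pMul (hR : HasPRank R p n) (M : AddSubgroup R) (k : ℕ) :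
    ((pMul p)^[k] M).index = M.index * (p ^ n) ^ k := by
  induction k with
  | zero => simp
  | succ k ih => rw [Function.iterate_succ_apply', hR.index_pMul, ih, pow_succ, mul_assoc]

theorem HasJumps.relIndex {L : AddSubgroup R} {s b : ℕ} {c : ℕ → ℕ} (h : HasJumps p L s c)
    (hb : b ≤ s) :
    (pColon p b L).relIndex (pColon p s L) = p ^ (∑ t ∈ Finset.Ico b s, c t) := by
  induction s, hb using Nat.le_induction with
  | base => simp
  | succ s hbs ih =>
    rw [Finset.sum_Ico_succ_top hbs, pow_add, ← ih fun t ht => h t (by omega),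
      ← h s (Nat.lt_succ_self s), AddSubgroup.relIndex_mul_relIndex _ _ _
        (pColon_mono_right hbs L) (pColon_mono_right (Nat.le_succ s) L)]

/-- The codimension gained at stage `t` from an element `y ∈ N_b` with `1, y, y ^ 2`
independent modulo `p`. -/
def squareGain (b t : ℕ) : ℕ := if t < b then 1 else if t < 2 * b then 2 else 3

theorem HasPRank.encard_with_element (hR : HasPRank R p n) (hn : n ≠ 0) {M : AddSubgroup R}
    (hM : M.index ≠ 0) (s b : ℕ) (c : ℕ → ℕ) {y : R} (hy : ¬ IsQuadratic (redMod R p y)) :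
    {L : Subring R | pColon p s L.toAddSubgroup = M ∧ HasJumps p L.toAddSubgroup s c ∧
      y ∈ pColon p b L.toAddSubgroup}.encard ≤
      (∏ t ∈ Finset.range s, (2 ^ n * p ^ (c t * (n - squareGain b t - c t))) : ℕ) := by
  refine le_trans (Set.encard_le_encard_of_injOn (f := Subring.toAddSubgroup) ?_
    (Subring.toAddSubgroup_injective.injOn))
    (hR.encard_chain hM s c (squareGain b)
      (fun t => if t < b then {1} else if t < 2 * b then {1, y} else {1, y, y ^ 2}) ?_)
  · rintro L ⟨h1, h2, h3⟩
    refine ⟨h1, h2, fun t _ => ?_⟩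
    have hsq : y ^ 2 ∈ pColon p (2 * b) L.toAddSubgroup := by
      rw [sq, two_mul]; exact mul_mem_pColon h3 h3
    split_ifs with hb hb2
    · rintro x rfl
      exact one_mem_pColon L t
    · rintro x (rfl | rfl)
      · exact one_mem_pColon L t
      · exact pColon_mono_right (not_lt.1 hb) _ h3
    · rintro x (rfl | rfl | rfl)
      · exact one_mem_pColon L t
      · exact pColon_mono_right (not_lt.1 hb) _ h3
      · exact pColon_mono_right (not_lt.1 hb2) _ hsq
  · intro t _
    simp only [squareGain]
    split_ifs with hb hb2
    · rw [hR.card_redMap_closure_one hn, pow_one]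
    · exact hR.card_redMap_pair_of_not_isQuadratic hn hy
    · exact hR.card_redMap_triple hn hy

theorem HasPRank.encard_doubleCount (hR : HasPRank R p n) [IsReduced (R ⧸ Ideal.span {(p : R)})]
    (hn : n ≠ 0) (hp2 : p ≠ 2) {M : AddSubgroup R} (hM : M.index ≠ 0) {s b : ℕ} (hb : b < s)
    (c : ℕ → ℕ) (hc : c b + 3 ≤ n) :
    {L : Subring R | pColon p s L.toAddSubgroup = M ∧ HasJumps p L.toAddSubgroup s c}.encard ≤
      (6 * p ^ (∑ t ∈ Finset.Ico b s, c t) *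
        ∏ t ∈ Finset.range s, (2 ^ n * p ^ (c t * (n - squareGain b t - c t))) : ℕ) := by
  classical
  set F := {L : Subring R | pColon p s L.toAddSubgroup = M ∧ HasJumps p L.toAddSubgroup s c}
  have := hR.finite_quot
  have := hR.charP hn
  have hFfin : F.Finite := by
    refine Set.finite_of_encard_le_coe (
      k := ∏ t ∈ Finset.range s, (2 ^ n * p ^ (c t * (n - 0 - c t)))) ?_
    refine le_trans (Set.encard_le_encard_of_injOn (f := Subring.toAddSubgroup) ?_
      (Subring.toAddSubgroup_injective.injOn))
      (hR.encard_chain hM s c (fun _ => 0) (fun t => ∅) ?_)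
    · rintro L ⟨h1, h2⟩
      exact ⟨h1, h2, fun t _ => Set.empty_subset _⟩
    · intro t _
      rw [pow_zero]
      exact Nat.card_pos
  set P := (pMul p)^[s] M with hP
  have hPidx : P.index ≠ 0 := by
    rw [hP, hR.index_iterate_pMul]
    exact mul_ne_zero hM (pow_pos (pow_pos hR.prime.pos _) _).ne'
  have hQfin : Finite (R ⧸ P) := Nat.finite_of_card_ne_zero hPidx
  have hker : P ≤ (redMod R p).toAddMonoidHom.ker := by
    intro x hx
    obtain ⟨y, -, rfl⟩ := (mem_iterate_pMul s).1 hx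
    refine redMod_eq_zero.2 ⟨(p : R) ^ (s - 1) * y, ?_⟩
    rw [← mul_assoc, ← pow_succ', Nat.sub_add_cancel (by omega)]
  set q : R →+ R ⧸ P := QuotientAddGroup.mk' P
  set g : R ⧸ P →+ R ⧸ Ideal.span {(p : R)} := QuotientAddGroup.lift P _ hker
  have hgq (x : R) : g (q x) = redMod R p x := rfl
  have hqs : Function.Surjective q := QuotientAddGroup.mk'_surjective P
  choose o ho using hqs
  have hmem {H : AddSubgroup R} (hPH : P ≤ H) {x : R} (hx : q x ∈ H.map q) : x ∈ H := by
    have : x ∈ (H.map q).comap q := hx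
    rwa [AddSubgroup.comap_map_eq, QuotientAddGroup.ker_mk', sup_eq_left.2 hPH] at this
  have hcardW (H : AddSubgroup R) : Nat.card (H.map q) = P.relIndex H := by
    rw [← AddSubgroup.relIndex_ker, QuotientAddGroup.ker_mk']
  have hPle {L : Subring R} (hL : L ∈ F) (t : ℕ) : P ≤ pColon p t L.toAddSubgroup := by
    refine le_trans ?_ (le_pColon t _)
    intro x hx
    obtain ⟨y, hy, rfl⟩ := (mem_iterate_pMul s).1 hx
    rw [← hL.1] at hy
    exact hy
  have hPM : P ≤ M := by
    intro x hx
    obtain ⟨y, hy, rfl⟩ := (mem_iterate_pMul s).1 hx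
    exact natCast_pow_mul_mem _ _ _ hy
  set B := ∏ t ∈ Finset.range s, (2 ^ n * p ^ (c t * (n - squareGain b t - c t))) with hB
  set q₁ := p ^ (∑ t ∈ Finset.Ico b s, c t)
  have hq₁ : 0 < q₁ := pow_pos hR.prime.pos _
  have hMpos : 0 < Nat.card (M.map q) := Nat.card_pos
  -- the number of admissible classes
  have hW {L : Subring R} (hL : L ∈ F) :
      Nat.card (M.map q) = Nat.card ((pColon p b L.toAddSubgroup).map q) * q₁ := by
    have hle : pColon p b L.toAddSubgroup ≤ M := by
      rw [← hL.1]; exact pColon_mono_right hb.le _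
    rw [hcardW, hcardW, ← AddSubgroup.relIndex_mul_relIndex _ _ _ (hPle hL b) hle,
      ← hL.1, hL.2.relIndex hb.le]
  have hgood {L : Subring R} (hL : L ∈ F) :
      Nat.card ((pColon p b L.toAddSubgroup).map q) ≤
        6 * {w : R ⧸ P | w ∈ (pColon p b L.toAddSubgroup).map q ∧ ¬ IsQuadratic (g w)}.ncard := by
    refine card_le_mul_ncard_preimage g _ (fun y => ¬ IsQuadratic y) 6 ?_
    refine card_le_six_mul_ncard_not_isQuadratic hR.prime hp2 _ ?_
    have hLi : L.toAddSubgroup.index ≠ 0 := by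
      rw [hL.2.index, hL.1]
      exact mul_ne_zero (pow_pos hR.prime.pos _).ne' hM
    have hmap : ((pColon p b L.toAddSubgroup).map q).map g =
        redMap p (pColon p b L.toAddSubgroup) := by
      rw [AddSubgroup.map_map]; rfl
    have hj : jump p L.toAddSubgroup b = c b := by
      have h1 := hL.2 b hb
      rw [hR.relIndex_eq_jump hLi] at h1
      exact Nat.pow_right_injective hR.prime.two_le h1
    rw [hmap, hR.card_redMap hLi, hj]
    exact Nat.pow_le_pow_right hR.prime.pos (by omega)
  set Y : Finset (R ⧸ P) := (Set.toFinite (M.map q : Set (R ⧸ P))).toFinset with hY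
  have hYcard : Y.card = Nat.card (M.map q) := by
    rw [hY, ← Set.ncard_eq_toFinset_card]; rfl
  by_cases hne : F = ∅
  · rw [hne]; simp
  obtain ⟨L₀, hL₀⟩ := Set.nonempty_iff_ne_empty.2 hne
  set w₀ := Nat.card ((pColon p b L₀.toAddSubgroup).map q) with hw₀
  have hw₀L {L : Subring R} (hL : L ∈ F) :
      Nat.card ((pColon p b L.toAddSubgroup).map q) = w₀ :=
    Nat.eq_of_mul_eq_mul_right hq₁ ((hW hL).symm.trans (hW hL₀))
  have key := Finset.card_mul_le_card_mul (s := hFfin.toFinset) (t := Y)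
    (fun (L : Subring R) (w : R ⧸ P) => w ∈ (pColon p b L.toAddSubgroup).map q ∧
      ¬ IsQuadratic (g w)) (m := (w₀ + 5) / 6) (n := B) ?_ ?_
  · have hcount : hFfin.toFinset.card ≤ 6 * q₁ * B := by
      rw [hYcard, hW hL₀] at key
      have hpos : 0 < w₀ := Nat.card_pos
      have h6 : w₀ ≤ 6 * ((w₀ + 5) / 6) := by omega
      have h7 : 0 < (w₀ + 5) / 6 := by omega
      refine Nat.le_of_mul_le_mul_right (key.trans ?_) h7
      calc w₀ * q₁ * B ≤ 6 * ((w₀ + 5) / 6) * q₁ * B := by gcongr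
        _ = _ := by ring
    rw [hFfin.encard_eq_coe_toFinset_card]
    exact_mod_cast hcount
  · intro L hL
    rw [Set.Finite.mem_toFinset] at hL
    have h1 := hgood hL
    rw [hw₀L hL] at h1
    have h2 : {w : R ⧸ P | w ∈ (pColon p b L.toAddSubgroup).map q ∧ ¬ IsQuadratic (g w)} ⊆
        (Y.bipartiteAbove (fun (L : Subring R) (w : R ⧸ P) =>
          w ∈ (pColon p b L.toAddSubgroup).map q ∧ ¬ IsQuadratic (g w)) L : Set (R ⧸ P)) := by
      intro w hw
      rw [Finset.mem_coe, Finset.mem_bipartiteAbove, hY, Set.Finite.mem_toFinset]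
      refine ⟨AddSubgroup.map_mono ?_ hw.1, hw⟩
      rw [← hL.1]; exact pColon_mono_right hb.le _
    have h3 := Set.ncard_le_ncard h2 (Finset.finite_toSet _)
    rw [Set.ncard_coe_finset] at h3
    omega
  · intro w hw
    by_cases hq : IsQuadratic (g w)
    · rw [Finset.bipartiteBelow, Finset.filter_false_of_mem]
      · simp
      · exact fun L _ h => h.2 hq
    · rw [← ho w, hgq] at hq
      have h1 := hR.encard_with_element hn hM s b c hq
      rw [← ENat.natCast_le_natCast, ← Set.encard_coe_eq_coe_finsetCard]
      refine le_trans (Set.encard_le_encard ?_) h1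
      intro L hL
      rw [Finset.mem_coe, Finset.mem_bipartiteBelow, Set.Finite.mem_toFinset] at hL
      refine ⟨hL.1.1, hL.1.2, hmem (hPle hL.1 b) ?_⟩
      rw [ho]
      exact hL.2.1

end DoubleCount

section Numerics

theorem mul_sub_self_nonneg (m : ℤ) : 0 ≤ m * (m - 1) := by
  rcases le_or_gt m 0 with h | h
  · nlinarith
  · exact mul_nonneg h.le (by omega)

theorem mul_sub_three_ge (m : ℤ) : -2 ≤ m * (m - 3) := by
  have : 0 ≤ (m - 1) * ((m - 1) - 1) := mul_sub_self_nonneg (m - 1)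
  nlinarith

theorem stage_nonlocal_top {n c : ℤ} (hn : 6 ≤ n) (hc : 0 ≤ c) :
    12 * (c * (n - 2 - c)) + 12 ≤ (6 * n - 14) * c + 3 * n * (n - 2 * c) := by
  have h1 : (0 : ℤ) ≤ (n - 2 * c) ^ 2 := sq_nonneg _
  rcases (by omega : c = 0 ∨ c = 1 ∨ 2 ≤ c) with rfl | rfl | h
  · nlinarith
  · nlinarith
  · nlinarith

theorem stage_nonlocal {n c k : ℤ} (hn : 6 ≤ n) (hc : 0 ≤ c) (hck : c + 1 ≤ k) (hk : k ≤ n - 1) :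
    12 * (c * (k - 1 - c)) + 12 ≤ (6 * n - 14) * c + 3 * n * (k - 2 * c) := by
  rcases le_total (12 * c) (3 * n) with h | h
  · have h1 := mul_nonneg (sub_nonneg.2 h) (sub_nonneg.2 hck)
    have h2 : 0 ≤ c * (3 * n - 14) := mul_nonneg hc (by omega)
    nlinarith
  · have h1 := mul_nonneg (sub_nonneg.2 h) (sub_nonneg.2 hk)
    have h2 : 0 ≤ 3 * (n - 2 * c) ^ 2 - 5 * (n - 2 * c) + 2 * n - 12 := by
      have h3 := mul_sub_self_nonneg (n - 2 * c)
      rcases (by omega : n - 2 * c ≤ 0 ∨ n - 2 * c = 1 ∨ 2 ≤ n - 2 * c) with h4 | h4 | h4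
      · nlinarith
      · rw [h4]; omega
      · nlinarith
    nlinarith

/-- The value of `12` times the gain of a stage, in the case of one known residue. -/
def stageGain (n c k x : ℤ) : ℤ := (6 * n - 14) * c + (3 * n - 4) * (k - 2 * c) - 12 * x

theorem stageGain_first {n c : ℤ} (hn : 6 ≤ n) (hc : c = n - 1 ∨ c = n - 2) :
    n + 6 ≤ stageGain n c n (c * (n - 1 - c)) := by
  rcases hc with rfl | rfl <;> unfold stageGain <;> nlinarith

theorem stageGain_zero {n : ℤ} (hn : 6 ≤ n) :
    n + 15 ≤ stageGain n (n - 1) n ((n - 1) * (n - 1 - (n - 1))) := by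
  unfold stageGain; nlinarith

theorem stageGain_middle {n c : ℤ} :
    -n ≤ stageGain n c n (c * (n - 2 - c) + c) := by
  have := mul_sub_self_nonneg (n - 2 * c)
  unfold stageGain; nlinarith

theorem stageGain_late {n c : ℤ} (hn : 6 ≤ n) :
    3 ≤ stageGain n c n (c * (n - 3 - c) + c) := by
  have := mul_sub_three_ge (n - 2 * c)
  unfold stageGain; nlinarith

theorem stageGain_lower {n c k : ℤ} (hn : 6 ≤ n) (hc : 0 ≤ c) (hck : c + 1 ≤ k)
    (hk : k ≤ n - 1) : 3 ≤ stageGain n c k (c * (k - 1 - c)) := by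
  unfold stageGain
  rcases le_total (12 * c) (3 * n - 4) with h | h
  · have h1 := mul_nonneg (sub_nonneg.2 h) (sub_nonneg.2 hck)
    have h2 : 0 ≤ c * (3 * n - 10) := mul_nonneg hc (by omega)
    nlinarith
  · have h1 := mul_nonneg (sub_nonneg.2 h) (sub_nonneg.2 hk)
    have h2 := mul_sub_three_ge (n - 2 * c)
    nlinarith

theorem sum_pairing (b e : ℕ) :
    ∑ t ∈ Finset.range e, (if t < b then (1 : ℤ) else if t < 2 * b then -1 else 0) =
      if e ≤ b then (e : ℤ) else if e ≤ 2 * b then 2 * b - e else 0 := by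
  induction e with
  | zero => simp
  | succ e ih =>
    rw [Finset.sum_range_succ, ih]
    split_ifs <;> push_cast <;> omega

theorem le_sum_of_pairing {e b : ℕ} {q : ℤ} (hq : 0 ≤ q) (g : ℕ → ℤ) (he : 0 < e) (hb : 0 < b)
    (h0 : q + 12 ≤ g 0) (h1 : ∀ t < e, t < b → q + 3 ≤ g t)
    (h2 : ∀ t < e, b ≤ t → t < 2 * b → -q + 3 ≤ g t) (h3 : ∀ t < e, 2 * b ≤ t → 3 ≤ g t) :
    3 * e + 9 ≤ ∑ t ∈ Finset.range e, g t := by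
  have h4 : ∀ t ∈ Finset.range e,
      3 + (if t = 0 then (9 : ℤ) else 0) +
        q * (if t < b then (1 : ℤ) else if t < 2 * b then -1 else 0) ≤ g t := by
    intro t ht
    rw [Finset.mem_range] at ht
    rcases Nat.eq_zero_or_pos t with rfl | htp
    · simp only [if_true, hb]; linarith
    · rw [if_neg htp.ne']
      split_ifs with hb1 hb2
      · linarith [h1 t ht hb1]
      · linarith [h2 t ht (not_lt.1 hb1) hb2]
      · linarith [h3 t ht (not_lt.1 hb2)]
  refine le_trans ?_ (Finset.sum_le_sum h4)
  rw [Finset.sum_add_distrib, Finset.sum_add_distrib, ← Finset.mul_sum, sum_pairing]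
  have h5 : ∑ t ∈ Finset.range e, (if t = 0 then (9 : ℤ) else 0) = 9 := by
    rw [Finset.sum_ite_eq' (Finset.range e) 0 (fun _ => (9 : ℤ)), if_pos (Finset.mem_range.2 he)]
  have h6 : (0 : ℤ) ≤ if e ≤ b then (e : ℤ) else if e ≤ 2 * b then 2 * b - e else 0 := by
    split_ifs <;> omega
  rw [h5]
  simp only [Finset.sum_const, Finset.card_range, nsmul_eq_mul]
  nlinarith [mul_nonneg hq h6]

theorem exists_threshold (P : ℕ → Prop) (hP : ∀ s t, s ≤ t → P t → P s) (e : ℕ) :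
    ∃ b ≤ e, (∀ t < b, P t) ∧ ∀ t, b ≤ t → t < e → ¬ P t := by
  induction e with
  | zero => exact ⟨0, le_rfl, fun t ht => by omega, fun t _ ht => by omega⟩
  | succ e ih =>
    by_cases h : P e
    · exact ⟨e + 1, le_rfl, fun t ht => hP t e (by omega) h, fun t h1 h2 => by omega⟩
    · obtain ⟨b, hb, h1, h2⟩ := ih
      refine ⟨b, by omega, h1, fun t h3 h4 => ?_⟩
      rcases Nat.lt_succ_iff_lt_or_eq.1 h4 with h5 | rfl
      · exact h2 t h3 h5
      · exact h

end Numerics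

section Fibers

variable {R : Type*} [CommRing R] {p n : ℕ}

theorem HasPRank.sum_jump_condGroup_le (hR : HasPRank R p n) [IsDedekindDomain R]
    [IsReduced (R ⧸ Ideal.span {(p : R)})] (hnp : n < p) {L : Subring R} {e i : ℕ}
    (hL : L.toAddSubgroup.index = p ^ i) (he : IsPExponent p L.toAddSubgroup e) :
    ∑ t ∈ Finset.range e, jump p (condGroup p L) t ≤ 2 * i := by
  have h1 := hR.condGroup_index_le hnp hL he
  rw [he.condGroup_index hR, hL, ← pow_mul, Nat.pow_le_pow_iff_right hR.prime.one_lt] at h1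
  omega

/-- The subrings of exponent `e` having the jumps and the conductor data of `L₀`. -/
def profileFiber (p e : ℕ) (L₀ : Subring R) : Set (Subring R) :=
  {L | IsPExponent p L.toAddSubgroup e ∧ L.toAddSubgroup.index ≠ 0 ∧
    (∀ t < e, jump p L.toAddSubgroup t = jump p L₀.toAddSubgroup t) ∧
    ∀ t < e, condMod p L t = condMod p L₀ t}

/-- Elements known to lie in `N_t` for every subring with the conductor data of `L`. -/
def condSet (p e : ℕ) (L : Subring R) (t : ℕ) : Set R :=
  teich p e '' (condMod p L t : Set (R ⧸ Ideal.span {(p : R)})) ∪ {1}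

theorem HasPRank.hasJumps_of_mem_profileFiber (hR : HasPRank R p n) {e : ℕ} {L₀ L : Subring R}
    (hL : L ∈ profileFiber p e L₀) {s : ℕ} (hs : s ≤ e) :
    HasJumps p L.toAddSubgroup s (jump p L₀.toAddSubgroup) := fun t ht => by
  rw [hR.relIndex_eq_jump hL.2.1, hL.2.2.1 t (by omega)]

theorem HasPRank.condSet_subset (hR : HasPRank R p n) {e t : ℕ} {L₀ L : Subring R}
    (hL : L ∈ profileFiber p e L₀) (ht : t < e) :
    condSet p e L₀ t ⊆ pColon p t L.toAddSubgroup := by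
  rintro x (⟨z, hz, rfl⟩ | rfl)
  · rw [← hL.2.2.2 t ht] at hz
    exact hL.1.teich_mem_of_condMod hR.prime.ne_zero hz
  · exact one_mem_pColon L t

theorem HasPRank.card_condSet (hR : HasPRank R p n) (hn : n ≠ 0)
    [IsReduced (R ⧸ Ideal.span {(p : R)})] {e t : ℕ} {L : Subring R}
    (he : IsPExponent p L.toAddSubgroup e) (ht : t < e) :
    p ^ (n - jump p (condGroup p L) t + 1) ≤
      Nat.card (redMap p (AddSubgroup.closure (condSet p e L t))) := by
  refine hR.card_redMap_teich_union_one hn e (he.one_notMem_condMod ht) ?_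
  rw [← hR.card_redMap (he.condGroup_index_ne_zero hR), ← condMod_toAddSubgroup]
  rfl

theorem prod_two_pow_mul_pow (n p e : ℕ) (x : ℕ → ℕ) :
    ∏ t ∈ Finset.range e, (2 ^ n * p ^ x t) = (2 ^ n) ^ e * p ^ ∑ t ∈ Finset.range e, x t := by
  rw [Finset.prod_mul_distrib, Finset.prod_const, Finset.card_range, Finset.prod_pow_eq_pow_sum]

theorem HasPRank.encard_nonlocal_fiber (hR : HasPRank R p n) [IsDedekindDomain R]
    [IsReduced (R ⧸ Ideal.span {(p : R)})] (hn : 6 ≤ n) (hnp : n < p) {L₀ : Subring R} {e i : ℕ}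
    (he0 : 0 < e) (hL₀ : L₀.toAddSubgroup.index = p ^ i) (he : IsPExponent p L₀.toAddSubgroup e)
    {z : R ⧸ Ideal.span {(p : R)}} (hz₀ : z ∈ redMap p L₀.toAddSubgroup)
    (hz : z ∉ AddSubgroup.zmultiples (1 : R ⧸ Ideal.span {(p : R)})) :
    {L ∈ profileFiber p e L₀ | z ∈ redMap p L.toAddSubgroup}.encard ≤
      (6 * (2 ^ n) ^ e * p ^ (((6 * n - 14) * i - 9 - 3 * e) / 12) : ℕ) := by
  set c := jump p L₀.toAddSubgroup with hc
  set k := jump p (condGroup p L₀) with hk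
  have hL₀' : L₀.toAddSubgroup.index ≠ 0 := by rw [hL₀]; exact (pow_pos hR.prime.pos _).ne'
  have hfin := hR.finite_quot
  have hck : ∀ t < e, c t < k t := fun t ht => hR.jump_lt_jump_condGroup hL₀' he ht
  have hkn : ∀ t, k t ≤ n := hR.jump_le (he.condGroup_index_ne_zero hR)
  have hsum : ∑ t ∈ Finset.range e, c t = i := hR.sum_jump hL₀ he.1
  have hsumk : ∑ t ∈ Finset.range e, k t ≤ 2 * i := hR.sum_jump_condGroup_le hnp hL₀ he
  set d : ℕ → ℕ := fun t => if k t < n then n - k t + 1 else 2 with hd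
  have hchain := hR.encard_chain (M := ⊤) (by simp) e c d
    (fun t => if k t < n then condSet p e L₀ t else {1, teich p e z}) ?_
  swap
  · intro t ht
    simp only [hd]
    split_ifs with h
    · exact hR.card_condSet (by omega) he ht
    · exact hR.card_redMap_pair (by omega) e hz
  rw [prod_two_pow_mul_pow] at hchain
  have hcd : ∀ t < e, (12 * (c t * (n - d t - c t) : ℕ) + 12 : ℤ) ≤
      (6 * n - 14) * c t + 3 * n * (k t - 2 * c t) := by
    intro t ht
    have h1 := hck t ht
    have h2 := hkn t
    simp only [hd]
    split_ifs with h
    · have h3 := stage_nonlocal (n := n) (c := c t) (k := k t) (by omega) (by omega) (by omega)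
        (by omega)
      have h4 : ((c t * (n - (n - k t + 1) - c t) : ℕ) : ℤ) = c t * (k t - 1 - c t) := by
        rw [Nat.cast_mul]; congr 1; omega
      rw [h4]; exact h3
    · have h3 : p ^ 2 ≤ p ^ (n - c t) := by
        rw [← hR.card_redMap hL₀']
        refine (hR.card_redMap_pair (by omega) e hz).trans (Nat.card_mono (Set.toFinite _) ?_)
        refine AddSubgroup.map_mono ((AddSubgroup.closure_le _).2 ?_)
        rintro x (rfl | rfl)
        · exact one_mem_pColon L₀ t
        · exact he.teich_mem hz₀ t
      rw [Nat.pow_le_pow_iff_right hR.prime.one_lt] at h3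
      have h5 := stage_nonlocal_top (n := n) (c := c t) (by omega) (by omega)
      have h4 : ((c t * (n - 2 - c t) : ℕ) : ℤ) = c t * (n - 2 - c t) := by
        rw [Nat.cast_mul]; congr 1; omega
      rw [h4, show (k t : ℤ) = n by omega]; exact h5
  have hX : 12 * ∑ t ∈ Finset.range e, c t * (n - d t - c t) + 12 * e ≤ (6 * n - 14) * i := by
    have h1 := Finset.sum_le_sum fun t ht => hcd t (Finset.mem_range.1 ht)
    rw [Finset.sum_add_distrib, Finset.sum_add_distrib, ← Finset.mul_sum, ← Finset.mul_sum,
      ← Finset.mul_sum, Finset.sum_sub_distrib, ← Finset.mul_sum] at h1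
    simp only [Finset.sum_const, Finset.card_range, nsmul_eq_mul, ← Nat.cast_sum, hsum] at h1
    have h2 : (3 * n : ℤ) * ((∑ t ∈ Finset.range e, k t : ℕ) - 2 * i) ≤ 0 :=
      mul_nonpos_of_nonneg_of_nonpos (by positivity) (by omega)
    zify [show 14 ≤ 6 * n by omega]
    push_cast at h1 h2 ⊢
    linarith
  refine le_trans (Set.encard_le_encard_of_injOn (f := Subring.toAddSubgroup) ?_
    (Subring.toAddSubgroup_injective.injOn)) (hchain.trans ?_)
  · rintro L ⟨hL, hzL⟩
    refine ⟨hL.1.1, hR.hasJumps_of_mem_profileFiber hL le_rfl, fun t ht => ?_⟩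
    split_ifs with h
    · exact hR.condSet_subset hL ht
    · rintro x (rfl | rfl)
      · exact one_mem_pColon L t
      · exact hL.1.teich_mem hzL t
  · rw [Nat.cast_le]
    refine Nat.mul_le_mul (Nat.le_mul_of_pos_left _ (by norm_num))
      (Nat.pow_le_pow_right hR.prime.pos ?_)
    rw [Nat.le_div_iff_mul_le (by norm_num)]
    omega

end Fibers

section LocalFibers

variable {R : Type*} [CommRing R] {p n : ℕ}

/-- Summing the stage gains: `x t` is the exponent contributed by the stage `t`. -/
theorem exponent_le_of_stageGain {n i e : ℕ} (hn : 6 ≤ n) (c k x : ℕ → ℕ)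
    (hsum : ∑ t ∈ Finset.range e, c t = i) (hsumk : ∑ t ∈ Finset.range e, k t ≤ 2 * i)
    (h : 3 * e + 9 ≤ ∑ t ∈ Finset.range e, stageGain n (c t) (k t) (x t)) :
    ∑ t ∈ Finset.range e, x t ≤ ((6 * n - 14) * i - 9 - 3 * e) / 12 := by
  simp only [stageGain] at h
  rw [Finset.sum_sub_distrib, Finset.sum_add_distrib, ← Finset.mul_sum, ← Finset.mul_sum,
      ← Finset.mul_sum, Finset.sum_sub_distrib, ← Finset.mul_sum] at h
  simp only [← Nat.cast_sum, hsum] at h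
  have h2 : (3 * n - 4 : ℤ) * ((∑ t ∈ Finset.range e, k t : ℕ) - 2 * i) ≤ 0 :=
    mul_nonpos_of_nonneg_of_nonpos (by omega) (by omega)
  have h3 : 12 * (∑ t ∈ Finset.range e, x t) + 9 + 3 * e ≤ (6 * n - 14) * i := by
    zify [show 14 ≤ 6 * n by omega]
    push_cast at h h2 ⊢
    linarith
  rw [Nat.le_div_iff_mul_le (by norm_num)]
  omega

theorem HasPRank.encard_local_fiber (hR : HasPRank R p n) [IsDedekindDomain R]
    [IsReduced (R ⧸ Ideal.span {(p : R)})] (hn : 6 ≤ n) (hnp : n < p) {L₀ : Subring R} {e i : ℕ}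
    (he0 : 0 < e) (hL₀ : L₀.toAddSubgroup.index = p ^ i) (he : IsPExponent p L₀.toAddSubgroup e)
    (hloc : jump p L₀.toAddSubgroup 0 + 1 = n) :
    (profileFiber p e L₀).encard ≤
      (6 * (2 ^ n) ^ e * p ^ (((6 * n - 14) * i - 9 - 3 * e) / 12) : ℕ) := by
  set c := jump p L₀.toAddSubgroup with hc
  set k := jump p (condGroup p L₀) with hk
  have hL₀' : L₀.toAddSubgroup.index ≠ 0 := by rw [hL₀]; exact (pow_pos hR.prime.pos _).ne'
  have hck : ∀ t < e, c t < k t := fun t ht => hR.jump_lt_jump_condGroup hL₀' he ht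
  have hkn : ∀ t, k t ≤ n := hR.jump_le (he.condGroup_index_ne_zero hR)
  have hca : Antitone c := hR.jump_antitone hL₀'
  have hka : Antitone k := hR.jump_antitone (he.condGroup_index_ne_zero hR)
  have hsum : ∑ t ∈ Finset.range e, c t = i := hR.sum_jump hL₀ he.1
  have hsumk : ∑ t ∈ Finset.range e, k t ≤ 2 * i := hR.sum_jump_condGroup_le hnp hL₀ he
  obtain ⟨e₀, he₀, hlow, hhigh⟩ := exists_threshold (fun t => k t = n)
    (fun s t hst ht => le_antisymm (hkn s) (ht ▸ hka hst)) e
  obtain ⟨b, hbe, hblow, hbhigh⟩ := exists_threshold (fun t => n ≤ c t + 2)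
    (fun s t hst ht => by have := hca hst; omega) e
  have hk0 : k 0 = n := by have := hck 0 he0; have := hkn 0; omega
  have he₀pos : 0 < e₀ := by
    by_contra h0
    exact hhigh 0 (by omega) he0 hk0
  have hbpos : 0 < b := by
    by_contra h0
    exact hbhigh 0 (by omega) he0 (by omega)
  have hlater : ∀ t < e, e₀ ≤ t →
      3 ≤ stageGain n (c t) (k t) ((c t * (n - (n - k t + 1) - c t) : ℕ) : ℤ) := by
    intro t ht het
    have h1 := hck t ht
    have h2 := hkn t
    have h3 := hhigh t het ht
    rw [show ((c t * (n - (n - k t + 1) - c t) : ℕ) : ℤ) = c t * (k t - 1 - c t) by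
      rw [Nat.cast_mul]; congr 1; omega]
    exact stageGain_lower (by omega) (by omega) (by omega) (by omega)
  have hfirst : ∀ t < e₀, t < b →
      (n + 6 : ℤ) ≤ stageGain n (c t) (k t) ((c t * (n - 1 - c t) : ℕ) : ℤ) := by
    intro t ht htb
    have h1 := hck t (by omega)
    have h2 := hblow t htb
    rw [hlow t ht] at h1 ⊢
    rw [show ((c t * (n - 1 - c t) : ℕ) : ℤ) = c t * (n - 1 - c t) by
      rw [Nat.cast_mul]; congr 1; omega]
    exact stageGain_first (by omega) (by omega)
  have hzero : (n + 15 : ℤ) ≤ stageGain n (c 0) (k 0) ((c 0 * (n - 1 - c 0) : ℕ) : ℤ) := by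
    rw [hk0, show n - 1 - c 0 = 0 by omega, show (c 0 : ℤ) = n - 1 by omega]
    have := stageGain_zero (n := n) (by omega)
    simpa using this
  rcases le_or_gt e₀ b with hbe₀ | hbe₀
  · have hX := exponent_le_of_stageGain hn c k (fun t => c t * (n - (n - k t + 1) - c t))
      hsum hsumk ?_
    · refine le_trans (Set.encard_le_encard_of_injOn (f := Subring.toAddSubgroup) ?_
        (Subring.toAddSubgroup_injective.injOn)) ((hR.encard_chain (M := ⊤) (by simp) e c
        (fun t => n - k t + 1) (condSet p e L₀)
        fun t ht => hR.card_condSet (by omega) he ht).trans ?_)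
      · exact fun L hL => ⟨hL.1.1, hR.hasJumps_of_mem_profileFiber hL le_rfl,
          fun t ht => hR.condSet_subset hL ht⟩
      · rw [Nat.cast_le, prod_two_pow_mul_pow]
        exact Nat.mul_le_mul (Nat.le_mul_of_pos_left _ (by norm_num))
          (Nat.pow_le_pow_right hR.prime.pos hX)
    · have hall : ∀ t < e, 3 ≤ stageGain n (c t) (k t)
          ((c t * (n - (n - k t + 1) - c t) : ℕ) : ℤ) := by
        intro t ht
        rcases lt_or_ge t e₀ with h | h
        · have := hfirst t h (by omega)
          rw [hlow t h] at this ⊢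
          rw [Nat.sub_self, zero_add]
          omega
        · exact hlater t ht h
      refine le_sum_of_pairing (q := 0) (b := e) le_rfl _ he0 he0 ?_ ?_ ?_ ?_
      · rw [hk0] at hzero ⊢
        rw [show n - n + 1 = 1 by omega]
        omega
      · exact fun t ht _ => by simpa using hall t ht
      · exact fun t ht h => by omega
      · exact fun t ht _ => hall t ht
  · -- the exponent of each stage
    set x : ℕ → ℕ := fun t => if t < e₀ then
      c t * (n - squareGain b t - c t) + (if b ≤ t then c t else 0)
      else c t * (n - (n - k t + 1) - c t) with hx
    have hcb : ∀ t, b ≤ t → c t + 3 ≤ n := fun t ht => by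
      have h1 := hbhigh b le_rfl (by omega)
      have h2 := hca ht
      omega
    have hX := exponent_le_of_stageGain hn c k x hsum hsumk ?_
    · set B := 6 * p ^ (∑ t ∈ Finset.Ico b e₀, c t) *
        ∏ t ∈ Finset.range e₀, (2 ^ n * p ^ (c t * (n - squareGain b t - c t))) with hB
      set B' := ∏ t ∈ Finset.range (e - e₀),
        (2 ^ n * p ^ (c (e₀ + t) * (n - (n - k (e₀ + t) + 1) - c (e₀ + t)))) with hB'
      have hcount : (profileFiber p e L₀).encard ≤ (B * B' : ℕ) := by
        refine Set.encard_le_mul_of_fibers (fun L => pColon p e₀ L.toAddSubgroup) _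
          {M : AddSubgroup R | pColon p (e - e₀) M = ⊤ ∧
            HasJumps p M (e - e₀) (fun t => c (e₀ + t)) ∧
            ∀ t < e - e₀, condSet p e L₀ (e₀ + t) ⊆ pColon p t M} B B' ?_ ?_ ?_
        · intro L hL
          refine ⟨?_, fun t ht => ?_, fun t ht => ?_⟩
          · rw [pColon_pColon, Nat.sub_add_cancel he₀, hL.1.1]
          · rw [pColon_pColon, pColon_pColon, add_right_comm, add_comm t e₀]
            exact hR.hasJumps_of_mem_profileFiber hL le_rfl (e₀ + t) (by omega)
          · rw [pColon_pColon, add_comm t e₀]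
            exact hR.condSet_subset hL (by omega)
        · exact hR.encard_chain (by simp) (e - e₀) (fun t => c (e₀ + t))
            (fun t => n - k (e₀ + t) + 1) (fun t => condSet p e L₀ (e₀ + t))
            fun t ht => hR.card_condSet (by omega) he (by omega)
        · rintro M ⟨hM, hMj, -⟩
          have hMi : M.index ≠ 0 := by
            rw [hMj.index, hM, AddSubgroup.index_top, mul_one]
            exact (pow_pos hR.prime.pos _).ne'
          refine le_trans (Set.encard_le_encard ?_)
            (hR.encard_doubleCount (by omega) (by omega) hMi hbe₀ c (hcb b le_rfl))
          rintro L ⟨hL, hLM⟩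
          exact ⟨hLM, hR.hasJumps_of_mem_profileFiber hL he₀⟩
      refine hcount.trans ?_
      rw [Nat.cast_le]
      have hBB : B * B' = 6 * (2 ^ n) ^ e * p ^ ∑ t ∈ Finset.range e, x t := by
        have h1 : ∑ t ∈ Finset.range e, x t = ∑ t ∈ Finset.Ico b e₀, c t +
            ∑ t ∈ Finset.range e₀, c t * (n - squareGain b t - c t) +
            ∑ t ∈ Finset.range (e - e₀),
              c (e₀ + t) * (n - (n - k (e₀ + t) + 1) - c (e₀ + t)) := by
          rw [← Finset.sum_range_add_sum_Ico x he₀, Finset.sum_Ico_eq_sum_range]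
          congr 1
          · rw [Finset.sum_congr rfl (fun t ht => by
              simp only [hx]; rw [if_pos (Finset.mem_range.1 ht)]), Finset.sum_add_distrib, add_comm]
            congr 1
            rw [← Finset.sum_filter]
            refine Finset.sum_congr ?_ fun _ _ => rfl
            ext t
            simp only [Finset.mem_filter, Finset.mem_range, Finset.mem_Ico]
            omega
          · refine Finset.sum_congr rfl fun t _ => ?_
            simp only [hx]
            rw [if_neg (by omega)]
        rw [h1, hB, hB', prod_two_pow_mul_pow, prod_two_pow_mul_pow, pow_add, pow_add]
        have h2 : (2 ^ n) ^ e = (2 ^ n) ^ e₀ * (2 ^ n) ^ (e - e₀) := by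
          rw [← pow_add, Nat.add_sub_cancel' he₀]
        rw [h2]
        ring
      rw [hBB]
      exact Nat.mul_le_mul_left _ (Nat.pow_le_pow_right hR.prime.pos hX)
    · have hxfirst : ∀ t < e₀, t < b → x t = c t * (n - 1 - c t) := by
        intro t ht htb
        simp only [hx, squareGain]
        rw [if_pos ht, if_pos htb, if_neg (by omega), add_zero]
      refine le_sum_of_pairing (q := n + 3) (b := b) (by omega) _ he0 hbpos ?_ ?_ ?_ ?_
      · rw [hxfirst 0 he₀pos hbpos]; omega
      · intro t ht htb
        rw [hxfirst t (by omega) htb]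
        have := hfirst t (by omega) htb
        omega
      · intro t ht htb htb2
        by_cases hte : t < e₀
        · have h1 : (x t : ℤ) = c t * (n - 2 - c t) + c t := by
            have h2 : x t = c t * (n - 2 - c t) + c t := by
              simp only [hx, squareGain]
              rw [if_pos hte, if_neg (by omega), if_pos htb2, if_pos htb]
            have h3 := hcb t htb
            rw [h2, Nat.cast_add, Nat.cast_mul]
            congr 2
            omega
          have := stageGain_middle (n := n) (c := c t)
          rw [h1, hlow t hte]
          omega
        · have h1 : x t = c t * (n - (n - k t + 1) - c t) := by
            simp only [hx]; rw [if_neg hte]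
          have := hlater t ht (by omega)
          rw [h1]
          omega
      · intro t ht htb
        by_cases hte : t < e₀
        · have h1 : (x t : ℤ) = c t * (n - 3 - c t) + c t := by
            have h2 : x t = c t * (n - 3 - c t) + c t := by
              simp only [hx, squareGain]
              rw [if_pos hte, if_neg (by omega), if_neg (by omega), if_pos (by omega)]
            have h3 := hcb t (by omega)
            rw [h2, Nat.cast_add, Nat.cast_mul]
            congr 2
            omega
          have := stageGain_late (n := n) (c := c t) (by omega)
          rw [h1, hlow t hte]
          omega
        · have h1 : x t = c t * (n - (n - k t + 1) - c t) := by
            simp only [hx]; rw [if_neg hte]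
          rw [h1]
          exact hlater t ht (by omega)

end LocalFibers

section Count

variable {R : Type*} [CommRing R] {p n : ℕ}

/-- The jumps and the conductor data of a subring, up to the exponent `e`. -/
noncomputable def profile (p n e : ℕ) (L : Subring R) :
    Fin e → Fin (n + 1) × Ideal (R ⧸ Ideal.span {(p : R)}) :=
  fun t => (Fin.ofNat (n + 1) (jump p L.toAddSubgroup t), condMod p L t)

theorem HasPRank.mem_profileFiber (hR : HasPRank R p n) {e : ℕ} {L L₀ : Subring R}
    (hL : L.toAddSubgroup.index ≠ 0) (hL₀ : L₀.toAddSubgroup.index ≠ 0)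
    (he : IsPExponent p L.toAddSubgroup e) (h : profile p n e L = profile p n e L₀) :
    L ∈ profileFiber p e L₀ := by
  refine ⟨he, hL, fun t ht => ?_, fun t ht => congrArg Prod.snd (congrFun h ⟨t, ht⟩)⟩
  have h1 := congrArg Fin.val (congrArg Prod.fst (congrFun h ⟨t, ht⟩))
  simp only [profile, Fin.ofNat] at h1
  rwa [Nat.mod_eq_of_lt (Nat.lt_succ_of_le (hR.jump_le hL t)),
    Nat.mod_eq_of_lt (Nat.lt_succ_of_le (hR.jump_le hL₀ t))] at h1

theorem HasPRank.encard_profile_le (hR : HasPRank R p n) (hn : n ≠ 0)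
    [IsReduced (R ⧸ Ideal.span {(p : R)})] (e : ℕ) :
    (Set.univ : Set (Fin e → Fin (n + 1) × Ideal (R ⧸ Ideal.span {(p : R)}))).encard ≤
      (((n + 1) * 2 ^ n) ^ e : ℕ) := by
  have := hR.finite_quot
  have := hR.charP hn
  have : Finite (Ideal (R ⧸ Ideal.span {(p : R)})) :=
    Finite.of_injective (fun I => (I : Set (R ⧸ Ideal.span {(p : R)}))) SetLike.coe_injective
  rw [Set.encard_univ, ENat.card_eq_coe_natCard, Nat.cast_le, Nat.card_fun, Nat.card_prod]
  simp only [Nat.card_eq_fintype_card, Fintype.card_fin]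
  exact Nat.pow_le_pow_left (Nat.mul_le_mul_left _ (card_ideal_le hR.prime hR.card)) e

theorem HasPRank.encard_isPExponent_le (hR : HasPRank R p n) [IsDedekindDomain R]
    [IsReduced (R ⧸ Ideal.span {(p : R)})] (hn : 6 ≤ n) (hnp : n < p) {e : ℕ} (he0 : 0 < e)
    (i : ℕ) :
    {L : Subring R | L.toAddSubgroup.index = p ^ i ∧ IsPExponent p L.toAddSubgroup e}.encard ≤
      (6 * ((n + 1) * n ^ n + 1) * ((n + 1) * 2 ^ n * 2 ^ n) ^ e *
        p ^ (((6 * n - 14) * i - 9 - 3 * e) / 12) : ℕ) := by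
  set A := R ⧸ Ideal.span {(p : R)} with hA
  have := hR.finite_quot
  have hchar := hR.charP (by omega)
  set S := {L : Subring R | L.toAddSubgroup.index = p ^ i ∧ IsPExponent p L.toAddSubgroup e}
  set B := 6 * (2 ^ n) ^ e * p ^ (((6 * n - 14) * i - 9 - 3 * e) / 12) with hB
  have hne {L : Subring R} (hL : L ∈ S) : L.toAddSubgroup.index ≠ 0 := by
    rw [hL.1]; exact (pow_pos hR.prime.pos _).ne'
  obtain ⟨Z, hZcard, hZ1, hZ2⟩ := exists_bounded_hitting_set (A := A) hR.prime hR.card (by omega)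
  have hlocal : {L ∈ S | redMap p L.toAddSubgroup ≤ AddSubgroup.zmultiples (1 : A)}.encard ≤
      (B * ((n + 1) * 2 ^ n) ^ e : ℕ) := by
    refine Set.encard_le_mul_of_fibers (profile p n e) _ Set.univ _ _ (fun _ _ => Set.mem_univ _)
      (hR.encard_profile_le (by omega) e) fun y _ => ?_
    rcases Set.eq_empty_or_nonempty {L | L ∈ {L ∈ S | redMap p L.toAddSubgroup ≤
      AddSubgroup.zmultiples (1 : A)} ∧ profile p n e L = y} with h | ⟨L₀, ⟨hL₀, hl⟩, rfl⟩
    · rw [h]; simp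
    · refine le_trans (Set.encard_le_encard ?_)
        (hR.encard_local_fiber hn hnp he0 hL₀.1 hL₀.2 (L₀ := L₀) ?_)
      · rintro L ⟨⟨hL, -⟩, hp⟩
        exact hR.mem_profileFiber (hne hL) (hne hL₀) hL.2 hp
      · have h1 : redMap p L₀.toAddSubgroup = AddSubgroup.zmultiples (1 : A) := by
          refine le_antisymm hl ?_
          rw [AddSubgroup.zmultiples_le]
          exact ⟨1, L₀.one_mem, map_one (redMod R p)⟩
        have h2 := hR.card_redMap (hne hL₀) 0
        rw [pColon_zero, h1, hR.card_zmultiples_one (by omega)] at h2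
        have h3 := Nat.pow_right_injective hR.prime.two_le ((pow_one p).trans h2)
        omega
  have hnonlocal :
      {L ∈ S | ¬ redMap p L.toAddSubgroup ≤ AddSubgroup.zmultiples (1 : A)}.encard ≤
      (B * (((n + 1) * 2 ^ n) ^ e * ((n + 1) * n ^ n)) : ℕ) := by
    choose! z hzZ hzL using hZ2
    refine Set.encard_le_mul_of_fibers
      (fun L => (profile p n e L, z (L.map (redMod R p)))) _ (Set.univ ×ˢ Z) _ _ ?_ ?_ ?_
    · rintro L ⟨-, hL⟩
      exact ⟨Set.mem_univ _, hzZ (L.map (redMod R p)) hL⟩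
    · rw [Set.encard_prod, Nat.cast_mul]
      exact mul_le_mul' (hR.encard_profile_le (by omega) e) hZcard
    · rintro y -
      rcases Set.eq_empty_or_nonempty {L | L ∈ {L ∈ S | ¬ redMap p L.toAddSubgroup ≤
        AddSubgroup.zmultiples (1 : A)} ∧ (profile p n e L, z (L.map (redMod R p))) = y} with
        h | ⟨L₀, ⟨hL₀, hl⟩, rfl⟩
      · rw [h]; simp
      · refine le_trans (Set.encard_le_encard ?_)
          (hR.encard_nonlocal_fiber hn hnp he0 hL₀.1 hL₀.2 (L₀ := L₀) (hzL (L₀.map (redMod R p)) hl)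
            (hZ1 _ (hzZ (L₀.map (redMod R p)) hl)))
        rintro L ⟨⟨hL, hlL⟩, hp⟩
        rw [Prod.mk.injEq] at hp
        refine ⟨hR.mem_profileFiber (hne hL) (hne hL₀) hL.2 hp.1, ?_⟩
        rw [← hp.2]
        exact hzL (L.map (redMod R p)) hlL
  have hS : S = {L ∈ S | redMap p L.toAddSubgroup ≤ AddSubgroup.zmultiples (1 : A)} ∪
      {L ∈ S | ¬ redMap p L.toAddSubgroup ≤ AddSubgroup.zmultiples (1 : A)} := by
    ext L
    simp only [Set.mem_union, Set.mem_ofPred_eq, ← and_or_left, em, and_true]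
  rw [hS]
  refine (Set.encard_union_le _ _).trans ((add_le_add hlocal hnonlocal).trans ?_)
  rw [← Nat.cast_add, Nat.cast_le, hB]
  apply le_of_eq
  rw [mul_pow ((n + 1) * 2 ^ n) (2 ^ n) e]
  generalize ((n + 1) * 2 ^ n) ^ e = u
  ring

theorem HasPRank.ncard_subring_le (hR : HasPRank R p n) [IsDedekindDomain R]
    [IsReduced (R ⧸ Ideal.span {(p : R)})] (hn : 6 ≤ n) (hnp : n < p)
    (hp : ((n + 1) * 2 ^ n * 2 ^ n) ^ 4 ≤ p) {i : ℕ} (hi : 0 < i) :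
    (Nat.card {L : Subring R // L.toAddSubgroup.index = p ^ i} : ℝ) ≤
      (6 * ((n + 1) * n ^ n + 1) * ((n + 1) * 2 ^ n * 2 ^ n) : ℕ) * i *
        (p : ℝ) ^ (((n : ℝ) / 2 - 7 / 6) * i - 1) := by
  set C := 6 * ((n + 1) * n ^ n + 1) with hC
  set D := (n + 1) * 2 ^ n * 2 ^ n with hD
  have hppos : (0 : ℝ) < p := by exact_mod_cast hR.prime.pos
  have hp1 : (1 : ℝ) ≤ p := by exact_mod_cast hR.prime.one_lt.le
  set S : ℕ → Set (Subring R) := fun e =>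
    {L : Subring R | L.toAddSubgroup.index = p ^ i ∧ IsPExponent p L.toAddSubgroup e}
  have hsub : {L : Subring R | L.toAddSubgroup.index = p ^ i} ⊆ ⋃ e ∈ Finset.Icc 1 i, S e := by
    intro L hL
    obtain ⟨e, hei, he⟩ := exists_isPExponent (L := L.toAddSubgroup) hL
    simp only [Set.mem_iUnion]
    refine ⟨e, Finset.mem_Icc.2 ⟨?_, hei⟩, hL, he⟩
    by_contra h0
    have h1 : e = 0 := by omega
    have h2 := hR.sum_jump hL he.1
    rw [h1] at h2
    simp at h2
    omega
  have hfin (e : ℕ) (he : e ∈ Finset.Icc 1 i) : (S e).Finite :=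
    Set.finite_of_encard_le_coe (hR.encard_isPExponent_le hn hnp (Finset.mem_Icc.1 he).1 i)
  have hterm (e : ℕ) (he : e ∈ Finset.Icc 1 i) :
      ((S e).ncard : ℝ) ≤ C * D * (p : ℝ) ^ (((n : ℝ) / 2 - 7 / 6) * i - 1) := by
    obtain ⟨he1, hei⟩ := Finset.mem_Icc.1 he
    have h1 := hR.encard_isPExponent_le hn hnp he1 i
    rw [← (hfin e he).cast_ncard_eq, Nat.cast_le] at h1
    have h2 : ((S e).ncard : ℝ) ≤ C * D ^ e * p ^ (((6 * n - 14) * i - 9 - 3 * e) / 12) := by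
      exact_mod_cast h1
    have h3 : (p : ℝ) ^ (((6 * n - 14) * i - 9 - 3 * e) / 12) ≤
        (p : ℝ) ^ (((n : ℝ) / 2 - 7 / 6) * i - 1 - ((e - 1 : ℕ) : ℝ) / 4) := by
      rw [← Real.rpow_natCast]
      refine Real.rpow_le_rpow_of_exponent_le hp1 ?_
      have h4 : 12 * (((6 * n - 14) * i - 9 - 3 * e) / 12) + 9 + 3 * e ≤ (6 * n - 14) * i := by
        have : 22 * i ≤ (6 * n - 14) * i := Nat.mul_le_mul_right _ (by omega)
        omega
      have h5 : (12 * ((((6 * n - 14) * i - 9 - 3 * e) / 12 : ℕ) : ℝ) + 9 + 3 * e) ≤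
          (6 * n - 14) * i := by
        have h6 : ((6 * n - 14 : ℕ) : ℝ) = 6 * n - 14 := by
          rw [Nat.cast_sub (by omega)]; push_cast; ring
        rw [← h6]
        exact_mod_cast h4
      rw [Nat.cast_sub he1]
      push_cast
      linarith
    have h7 : (D : ℝ) ^ (e - 1) ≤ (p : ℝ) ^ (((e - 1 : ℕ) : ℝ) / 4) := by
      have h8 : (D : ℝ) ≤ (p : ℝ) ^ (1 / 4 : ℝ) := by
        have h9 : (D : ℝ) ^ (4 : ℕ) ≤ p := by exact_mod_cast hp
        calc (D : ℝ) = ((D : ℝ) ^ (4 : ℕ)) ^ (1 / 4 : ℝ) := by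
              rw [← Real.rpow_natCast, ← Real.rpow_mul (by positivity)]; norm_num
          _ ≤ _ := Real.rpow_le_rpow (by positivity) h9 (by norm_num)
      calc (D : ℝ) ^ (e - 1) ≤ ((p : ℝ) ^ (1 / 4 : ℝ)) ^ (e - 1) :=
            pow_le_pow_left₀ (by positivity) h8 _
        _ = _ := by
            rw [← Real.rpow_natCast, ← Real.rpow_mul hppos.le]; congr 1; ring
    have hDe : (D : ℝ) ^ e = D * D ^ (e - 1) := by
      rw [← pow_succ', Nat.sub_add_cancel he1]
    calc ((S e).ncard : ℝ) ≤ C * (D * (p : ℝ) ^ (((e - 1 : ℕ) : ℝ) / 4)) *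
          (p : ℝ) ^ (((n : ℝ) / 2 - 7 / 6) * i - 1 - ((e - 1 : ℕ) : ℝ) / 4) := by
          refine h2.trans ?_
          rw [hDe]
          gcongr
      _ = C * D * ((p : ℝ) ^ (((e - 1 : ℕ) : ℝ) / 4) *
          (p : ℝ) ^ (((n : ℝ) / 2 - 7 / 6) * i - 1 - ((e - 1 : ℕ) : ℝ) / 4)) := by ring
      _ = _ := by rw [← Real.rpow_add hppos]; congr 2; ring
  have hcard : Nat.card {L : Subring R // L.toAddSubgroup.index = p ^ i} ≤
      ∑ e ∈ Finset.Icc 1 i, (S e).ncard := by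
    have h1 : Nat.card {L : Subring R // L.toAddSubgroup.index = p ^ i} =
        {L : Subring R | L.toAddSubgroup.index = p ^ i}.ncard := rfl
    rw [h1]
    refine (Set.ncard_le_ncard hsub ((Finset.Icc 1 i).finite_toSet.biUnion hfin)).trans ?_
    exact Finset.set_ncard_biUnion_le _ _
  calc (Nat.card {L : Subring R // L.toAddSubgroup.index = p ^ i} : ℝ)
      ≤ ∑ e ∈ Finset.Icc 1 i, ((S e).ncard : ℝ) := by exact_mod_cast hcard
    _ ≤ ∑ e ∈ Finset.Icc 1 i, (C * D * (p : ℝ) ^ (((n : ℝ) / 2 - 7 / 6) * i - 1)) :=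
        Finset.sum_le_sum hterm
    _ = _ := by
        rw [Finset.sum_const, Nat.card_Icc, nsmul_eq_mul]; push_cast; ring_nf

end Count

theorem NumberField.hasPRank (K : Type*) [Field K] [NumberField K] {p : ℕ} (hp : p.Prime) :
    HasPRank (𝓞 K) p (Module.finrank ℚ K) where
  prime := hp
  inj := mul_right_injective₀ (Nat.cast_ne_zero.mpr hp.ne_zero)
  card := by
    rw [← NumberField.RingOfIntegers.rank K, ← Ideal.absNorm_span_natCast,
      Ideal.absNorm_apply, Submodule.cardQuot_apply]

theorem NumberField.squarefree_span_natCast (K : Type*) [Field K] [NumberField K] {p : ℕ}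
    (hp : p.Prime) (hd : ¬ (p : ℤ) ∣ discr K) :
    Squarefree (Ideal.span {(p : 𝓞 K)}) := by
  have hp0 : (p : 𝓞 K) ≠ 0 := Nat.cast_ne_zero.mpr hp.ne_zero
  have hmap : (Ideal.span {(p : ℤ)}).map (algebraMap ℤ (𝓞 K)) = Ideal.span {(p : 𝓞 K)} := by
    simp [Ideal.map_span]
  have hI : Ideal.span {(p : 𝓞 K)} ≠ 0 := by simpa using hp0
  rw [squarefree_iff_irreducible_sq_not_dvd_of_ne_zero hI]
  intro P hP hdvd
  have hprime : P.IsPrime := Ideal.isPrime_of_prime hP.prime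
  have hmem : (p : 𝓞 K) ∈ P := by
    have := Ideal.dvd_iff_le.mp ((dvd_mul_right P P).trans hdvd)
    exact this (Ideal.mem_span_singleton_self _)
  have hunr : Algebra.IsUnramifiedAt ℤ P :=
    (not_dvd_discr_iff_forall_mem K (𝓞 K) (Nat.prime_iff_prime_int.mp hp)).mp hd P hprime
      (by simpa using hmem)
  have hmax : (Ideal.span {(p : ℤ)}).IsMaximal :=
    PrincipalIdealRing.isMaximal_of_irreducible (Nat.prime_iff_prime_int.mp hp).irreducible
  have hover : P.LiesOver (Ideal.span {(p : ℤ)}) := by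
    refine ⟨hmax.eq_of_le (Ideal.IsPrime.ne_top inferInstance) ?_⟩
    rw [Ideal.span_singleton_le_iff_mem, Ideal.mem_comap]
    simpa using hmem
  have h1 := Ideal.ramificationIdx_eq_one P ℤ
  rw [Ideal.IsDedekindDomain.ramificationIdx_eq_multiplicity (Ideal.span {(p : ℤ)}) P (by rw [hmap]; exact hI),
    hmap] at h1
  have hfin : FiniteMultiplicity P (Ideal.span {(p : 𝓞 K)}) :=
    FiniteMultiplicity.of_not_isUnit hP.not_isUnit hI
  have := hfin.le_multiplicity_of_pow_dvd (k := 2) (by rwa [sq])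
  omega

theorem NumberField.isReduced_quotient_span_natCast (K : Type*) [Field K] [NumberField K] {p : ℕ}
    (hp : p.Prime) (hd : ¬ (p : ℤ) ∣ discr K) :
    IsReduced (𝓞 K ⧸ Ideal.span {(p : 𝓞 K)}) := by
  rw [← Ideal.isRadical_iff_quotient_reduced]
  rintro x ⟨k, hk⟩
  have h := (squarefree_span_natCast K hp hd).isRadical k (Ideal.span {x})
  rw [Ideal.span_singleton_pow, Ideal.dvd_iff_le, Ideal.dvd_iff_le,
    Ideal.span_singleton_le_iff_mem, Ideal.span_singleton_le_iff_mem] at h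
  exact h hk

theorem summable_rpow_mul_natCast_mul_rpow {ε : ℝ} (hε : 0 < ε) :
    Summable fun q : ℕ × ℕ =>
      (q.1 : ℝ) ^ (-1 - ε) * (q.2 * (2 : ℝ) ^ (-((q.2 : ℝ) - 1) * ε)) := by
  have h1 : Summable fun p : ℕ => (p : ℝ) ^ (-1 - ε) :=
    Real.summable_nat_rpow.mpr (by linarith)
  have h2 : Summable fun i : ℕ => (i : ℝ) * (2 : ℝ) ^ (-((i : ℝ) - 1) * ε) := by
    have hr : ‖(2 : ℝ) ^ (-ε)‖ < 1 := by
      rw [Real.norm_of_nonneg (by positivity)]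
      exact Real.rpow_lt_one_of_one_lt_of_neg (by norm_num) (by linarith)
    refine ((summable_pow_mul_geometric_of_norm_lt_one 1 hr).mul_left ((2 : ℝ) ^ ε)).congr
      fun i => ?_
    rw [pow_one, ← Real.rpow_natCast, ← Real.rpow_mul (by norm_num), mul_left_comm,
      ← Real.rpow_add (by norm_num)]
    ring_nf
  exact h1.mul_of_nonneg h2 (fun _ => by positivity) (fun _ => by positivity)

/-- For a number field `K` of degree `n > 5` there is a finite set `S` of primes such
that for every real `σ > n/2 - 7/6` the double series
`∑_{p ∉ S} ∑_{i ≥ 2} a^{1,<}_{𝓞 K}(p^i) p^{-iσ}` converges. -/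
theorem stmt5 (K : Type*) [Field K] [NumberField K]
    (hdeg : 5 < Module.finrank ℚ K) :
    ∃ S : Finset ℕ, ∀ σ : ℝ, (Module.finrank ℚ K : ℝ) / 2 - 7 / 6 < σ →
      Summable (fun x : {q : ℕ × ℕ // q.1.Prime ∧ q.1 ∉ S ∧ 2 ≤ q.2} =>
        (numOrdersOfIndex K (x.1.1 ^ x.1.2) : ℝ) * (x.1.1 : ℝ) ^ (-(x.1.2 : ℝ) * σ)) := by
  set n := Module.finrank ℚ K with hn
  refine ⟨Finset.range (n + 1) ∪ Finset.range (((n + 1) * 2 ^ n * 2 ^ n) ^ 4) ∪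
    (discr K).natAbs.primeFactors, fun σ hσ => ?_⟩
  set C : ℕ := 6 * ((n + 1) * n ^ n + 1) * ((n + 1) * 2 ^ n * 2 ^ n) with hC
  have hε : 0 < σ - ((n : ℝ) / 2 - 7 / 6) := by linarith
  set ε := σ - ((n : ℝ) / 2 - 7 / 6) with hε_def
  refine Summable.of_nonneg_of_le (fun _ => by positivity) ?_
    (((summable_rpow_mul_natCast_mul_rpow hε).mul_left (C : ℝ)).comp_injective
      Subtype.val_injective)
  rintro ⟨⟨p, i⟩, hp, hS, hi⟩
  simp only [Finset.mem_union, Finset.mem_range, Nat.mem_primeFactors, not_or, not_lt, not_and]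
    at hp hS hi
  obtain ⟨⟨hnp, hCp⟩, hd⟩ := hS
  have hdvd : ¬ (p : ℤ) ∣ discr K := fun h =>
    hd hp (Int.natCast_dvd.mp h) (Int.natAbs_ne_zero.mpr (discr_ne_zero K))
  have hred := NumberField.isReduced_quotient_span_natCast K hp hdvd
  have hbound := (NumberField.hasPRank K hp).ncard_subring_le (by omega) (by omega) hCp
    (i := i) (by omega)
  have hp2 : (2 : ℝ) ≤ p := by exact_mod_cast hp.two_le
  have hp0 : (0 : ℝ) < p := by linarith
  have hi1 : (1 : ℝ) ≤ i := by exact_mod_cast (by omega : 1 ≤ i)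
  change (numOrdersOfIndex K (p ^ i) : ℝ) * (p : ℝ) ^ (-(i : ℝ) * σ) ≤
    C * ((p : ℝ) ^ (-1 - ε) * (i * (2 : ℝ) ^ (-((i : ℝ) - 1) * ε)))
  calc (numOrdersOfIndex K (p ^ i) : ℝ) * (p : ℝ) ^ (-(i : ℝ) * σ)
      ≤ C * i * (p : ℝ) ^ (((n : ℝ) / 2 - 7 / 6) * i - 1) * (p : ℝ) ^ (-(i : ℝ) * σ) :=
        mul_le_mul_of_nonneg_right hbound (by positivity)
    _ = C * ((p : ℝ) ^ (-1 - ε) * (i * (p : ℝ) ^ (-((i : ℝ) - 1) * ε))) := by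
        rw [mul_assoc, ← Real.rpow_add hp0, mul_left_comm ((p : ℝ) ^ (-1 - ε)),
          ← Real.rpow_add hp0, mul_assoc, hε_def]
        ring_nf
    _ ≤ _ := by
        gcongr _ * (_ * (_ * ?_))
        exact Real.rpow_le_rpow_of_nonpos (by norm_num) hp2 (by nlinarith)
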